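/- For every integer d ≥ 4 and every vector ω₀ ∈ ℝ^d there exist a C^∞ function H : ℝ^{2d} → ℝ with H(x,y) = ⟨ω₀, r(x,y)⟩ + O³(x,y) (i.e. H − ⟨ω₀, r⟩ vanishes at the origin together with its first and second total derivatives) and a global flow Φ of the Hamiltonian vector field X_H such that: (i) for every i ≤ d the set {p : r_i(p) = 0} is invariant under Φ, and for every p in ⋃_{i≤d}{r_i = 0} one has r_j(Φ(t,p)) = r_j(p) for all j ≤ d and all t ∈ ℝ (so these manifolds are foliated by invariant tori of dimension ≤ d−1); (ii) for every p with r_i(p) ≠ 0 for all i ≤ d there is a sequence of times (t_j) such that either |Φ(t_j,p)| → ∞ or dist(Φ(t_j,p), ⋃_{i≤d}{r_i = 0}) → 0. -/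

import Mathlib

open Filter Topology Metric Set

noncomputable section

/-- Phase space `ℝ^d × ℝ^d`, a point is `p = (x, y)`. -/
abbrev Ph (d : ℕ) := (Fin d → ℝ) × (Fin d → ℝ)

/-- Action coordinates `r_j(p) = (x_j² + y_j²)/2`. -/
def actJ {d : ℕ} (j : Fin d) (p : Ph d) : ℝ := (p.1 j ^ 2 + p.2 j ^ 2) / 2

/-- The Hamiltonian vector field `X_H = (∂H/∂y, -∂H/∂x)`. -/
def hamVF {d : ℕ} (H : Ph d → ℝ) (p : Ph d) : Ph d :=
  (fun j => fderiv ℝ H p (0, Pi.single j 1),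
   fun j => - fderiv ℝ H p (Pi.single j 1, 0))

/-- `Φ` is a global flow of the Hamiltonian vector field `X_H`. -/
def IsGlobalFlow {d : ℕ} (H : Ph d → ℝ) (Φ : ℝ → Ph d → Ph d) : Prop :=
  (∀ p, Φ 0 p = p) ∧ (∀ s t p, Φ (s + t) p = Φ s (Φ t p)) ∧
  (∀ p t, HasDerivAt (fun τ => Φ τ p) (hamVF H (Φ t p)) t)

/-- `H(x,y) = ⟨ω, r(x,y)⟩ + O³(x,y)`: the difference `H - ⟨ω, r⟩` vanishes at the
origin together with its first and second total derivatives. -/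
def IsEllipticNF {d : ℕ} (ω : Fin d → ℝ) (H : Ph d → ℝ) : Prop :=
  ∀ k ≤ 2, iteratedFDeriv ℝ k (fun p => H p - ∑ j, ω j * actJ j p) 0 = 0

namespace EllipticHam

variable {d : ℕ}

/-- The standard symplectic form on `ℝ^d × ℝ^d`. -/
def sympForm (u v : Ph d) : ℝ := ∑ j, (u.1 j * v.2 j - u.2 j * v.1 j)

lemma sympForm_add_left (u u' v : Ph d) :
    sympForm (u + u') v = sympForm u v + sympForm u' v := by
  simp only [sympForm, ← Finset.sum_add_distrib, Prod.fst_add, Prod.snd_add, Pi.add_apply]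
  exact Finset.sum_congr rfl fun j _ => by ring

lemma sympForm_smul_left (c : ℝ) (u v : Ph d) : sympForm (c • u) v = c * sympForm u v := by
  simp only [sympForm, Finset.mul_sum, Prod.smul_fst, Prod.smul_snd, Pi.smul_apply, smul_eq_mul]
  exact Finset.sum_congr rfl fun j _ => by ring

lemma sympForm_swap (u v : Ph d) : sympForm u v = -sympForm v u := by
  simp only [sympForm, ← Finset.sum_neg_distrib]
  exact Finset.sum_congr rfl fun j _ => by ring

lemma sympForm_add_right (u v v' : Ph d) :
    sympForm u (v + v') = sympForm u v + sympForm u v' := by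
  rw [sympForm_swap, sympForm_add_left, sympForm_swap v, sympForm_swap v']; ring

lemma sympForm_smul_right (c : ℝ) (u v : Ph d) : sympForm u (c • v) = c * sympForm u v := by
  rw [sympForm_swap, sympForm_smul_left, sympForm_swap v]; ring

lemma eq_of_sympForm_eq {u u' : Ph d} (h : ∀ v, sympForm u v = sympForm u' v) : u = u' := by
  refine Prod.ext (funext fun j => ?_) (funext fun j => ?_)
  · simpa [sympForm, Pi.single_apply] using h (0, Pi.single j 1)
  · simpa [sympForm, Pi.single_apply] using h (Pi.single j 1, 0)

lemma sum_single (v : Ph d) :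
    v = ∑ j, (v.1 j • ((Pi.single j 1, 0) : Ph d) + v.2 j • ((0, Pi.single j 1) : Ph d)) := by
  refine Prod.ext (funext fun i => ?_) (funext fun i => ?_) <;>
  simp [Prod.fst_sum, Prod.snd_sum, Finset.sum_apply, Pi.single_apply]

lemma sympForm_hamVF (H : Ph d → ℝ) (p v : Ph d) :
    sympForm (hamVF H p) v = fderiv ℝ H p v := by
  conv_rhs => rw [sum_single v]
  simp only [map_sum, map_add, map_smul, smul_eq_mul, sympForm, hamVF]
  exact Finset.sum_congr rfl fun j _ => by ring

/-- The Hamiltonian vector field as a continuous linear function of the differential. -/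
def hamL (d : ℕ) : (Ph d →L[ℝ] ℝ) →L[ℝ] Ph d :=
  (ContinuousLinearMap.pi fun j => ContinuousLinearMap.apply ℝ ℝ ((0, Pi.single j 1) : Ph d)).prod
    (ContinuousLinearMap.pi fun j =>
      -ContinuousLinearMap.apply ℝ ℝ ((Pi.single j 1, 0) : Ph d))

lemma hamVF_eq (H : Ph d → ℝ) (p : Ph d) : hamVF H p = hamL d (fderiv ℝ H p) := rfl

lemma contDiff_hamVF {H : Ph d → ℝ} (hH : ContDiff ℝ (⊤ : ℕ∞) H) :
    ContDiff ℝ (⊤ : ℕ∞) (hamVF H) :=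
  (hamL d).contDiff.comp (hH.fderiv_right (m := (⊤ : ℕ∞)) (by simp))

/-- The vector of actions. -/
def actV (p : Ph d) : Fin d → ℝ := fun j => actJ j p

lemma contDiff_actV {n : WithTop ℕ∞} : ContDiff ℝ n (actV : Ph d → Fin d → ℝ) := by
  unfold actV actJ
  fun_prop

lemma actJ_nonneg (j : Fin d) (p : Ph d) : 0 ≤ actJ j p := by unfold actJ; positivity

lemma actJ_eq_zero {j : Fin d} {p : Ph d} : actJ j p = 0 ↔ p.1 j = 0 ∧ p.2 j = 0 := by
  constructor
  · intro h
    unfold actJ at h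
    constructor <;> nlinarith [sq_nonneg (p.1 j), sq_nonneg (p.2 j)]
  · rintro ⟨h₁, h₂⟩
    simp [actJ, h₁, h₂]

/-- Clockwise rotation of the `j`-th plane by the angle `ν j`. -/
def rot (ν : Fin d → ℝ) (p : Ph d) : Ph d :=
  (fun j => Real.cos (ν j) * p.1 j + Real.sin (ν j) * p.2 j,
   fun j => Real.cos (ν j) * p.2 j - Real.sin (ν j) * p.1 j)

lemma actJ_rot (ν : Fin d → ℝ) (j : Fin d) (p : Ph d) : actJ j (rot ν p) = actJ j p := by
  simp only [actJ, rot]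
  linear_combination (p.1 j ^ 2 + p.2 j ^ 2) / 2 * Real.sin_sq_add_cos_sq (ν j)

lemma actV_rot (ν : Fin d → ℝ) (p : Ph d) : actV (rot ν p) = actV p :=
  funext fun j => actJ_rot ν j p

lemma rot_zero (p : Ph d) : rot 0 p = p := by simp [rot]

lemma rot_add (ν μ : Fin d → ℝ) (p : Ph d) : rot (ν + μ) p = rot ν (rot μ p) := by
  refine Prod.ext (funext fun j => ?_) (funext fun j => ?_) <;>
  · simp only [rot, Pi.add_apply, Real.cos_add, Real.sin_add]; ring

lemma continuous_rot : Continuous fun q : (Fin d → ℝ) × Ph d => rot q.1 q.2 := by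
  unfold rot
  fun_prop

/-- The frequency vector of the integrable Hamiltonian `ℓ ∘ actV`. -/
def freq (ℓ : (Fin d → ℝ) → ℝ) (r : Fin d → ℝ) : Fin d → ℝ :=
  fun j => fderiv ℝ ℓ r (Pi.single j 1)

lemma continuous_freq {ℓ : (Fin d → ℝ) → ℝ} (hℓ : ContDiff ℝ (⊤ : ℕ∞) ℓ) :
    Continuous (freq ℓ) := by
  have := hℓ.continuous_fderiv (by simp)
  unfold freq
  fun_prop

/-- The flow of the integrable Hamiltonian `ℓ ∘ actV`. -/
def intFlow (ℓ : (Fin d → ℝ) → ℝ) (t : ℝ) (p : Ph d) : Ph d := rot (t • freq ℓ (actV p)) p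

lemma hasFDerivAt_actJ (j : Fin d) (p : Ph d) :
    HasFDerivAt (actJ j : Ph d → ℝ)
      (p.1 j • ((ContinuousLinearMap.proj j).comp (ContinuousLinearMap.fst ℝ _ _)) +
       p.2 j • ((ContinuousLinearMap.proj j).comp (ContinuousLinearMap.snd ℝ _ _))) p := by
  have h1 : HasFDerivAt (fun p : Ph d => p.1 j)
      ((ContinuousLinearMap.proj j).comp (ContinuousLinearMap.fst ℝ _ _)) p :=
    ((ContinuousLinearMap.proj (R := ℝ) (φ := fun _ : Fin d => ℝ) j).comp
      (ContinuousLinearMap.fst ℝ (Fin d → ℝ) (Fin d → ℝ))).hasFDerivAt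
  have h2 : HasFDerivAt (fun p : Ph d => p.2 j)
      ((ContinuousLinearMap.proj j).comp (ContinuousLinearMap.snd ℝ _ _)) p :=
    ((ContinuousLinearMap.proj (R := ℝ) (φ := fun _ : Fin d => ℝ) j).comp
      (ContinuousLinearMap.snd ℝ (Fin d → ℝ) (Fin d → ℝ))).hasFDerivAt
  have := ((h1.pow 2).add (h2.pow 2)).const_mul (1 / 2)
  refine (this.congr_fderiv ?_).congr_of_eventuallyEq (.of_forall fun q => ?_)
  · ext v <;> simp <;> ring
  · simp [actJ]; ring

lemma fderiv_comp_actV {ℓ : (Fin d → ℝ) → ℝ} (hℓ : ContDiff ℝ (⊤ : ℕ∞) ℓ) (p v : Ph d) :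
    fderiv ℝ (fun q => ℓ (actV q)) p v =
      ∑ j, freq ℓ (actV p) j * (p.1 j * v.1 j + p.2 j * v.2 j) := by
  have h1 := (hℓ.differentiable (by simp) (actV p)).hasFDerivAt
  have h2 : HasFDerivAt (actV : Ph d → Fin d → ℝ) _ p :=
    hasFDerivAt_pi.2 fun j => hasFDerivAt_actJ j p
  have h3 := h1.comp p h2
  rw [show (fun q => ℓ (actV q)) = ℓ ∘ actV from rfl, h3.fderiv]
  simp only [ContinuousLinearMap.comp_apply]
  conv_lhs => rw [← (Finset.univ_sum_single (ContinuousLinearMap.pi _ v))]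
  rw [map_sum]
  refine Finset.sum_congr rfl fun j _ => ?_
  rw [← mul_one (ContinuousLinearMap.pi _ v j), ← smul_eq_mul, Pi.single_smul', map_smul]
  simp [freq, mul_comm]

lemma hamVF_comp_actV {ℓ : (Fin d → ℝ) → ℝ} (hℓ : ContDiff ℝ (⊤ : ℕ∞) ℓ) (p : Ph d) :
    hamVF (fun q => ℓ (actV q)) p =
      (fun j => freq ℓ (actV p) j * p.2 j, fun j => -(freq ℓ (actV p) j * p.1 j)) := by
  refine Prod.ext (funext fun j => ?_) (funext fun j => ?_) <;>
  simp [hamVF, fderiv_comp_actV hℓ, Pi.single_apply]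

lemma actV_intFlow (ℓ : (Fin d → ℝ) → ℝ) (t : ℝ) (p : Ph d) :
    actV (intFlow ℓ t p) = actV p := actV_rot _ _

lemma intFlow_add (ℓ : (Fin d → ℝ) → ℝ) (s t : ℝ) (p : Ph d) :
    intFlow ℓ (s + t) p = intFlow ℓ s (intFlow ℓ t p) := by
  rw [intFlow, add_smul, rot_add, intFlow, actV_intFlow]; rfl

lemma hasDerivAt_intFlow {ℓ : (Fin d → ℝ) → ℝ} (hℓ : ContDiff ℝ (⊤ : ℕ∞) ℓ) (t : ℝ) (p : Ph d) :
    HasDerivAt (fun τ => intFlow ℓ τ p) (hamVF (fun q => ℓ (actV q)) (intFlow ℓ t p)) t := by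
  rw [hamVF_comp_actV hℓ, actV_intFlow]
  have ha : ∀ j, HasDerivAt (fun τ : ℝ => τ * freq ℓ (actV p) j) (freq ℓ (actV p) j) t :=
    fun j => by simpa using (hasDerivAt_id t).mul_const (freq ℓ (actV p) j)
  refine HasDerivAt.prodMk (hasDerivAt_pi.2 fun j => ?_) (hasDerivAt_pi.2 fun j => ?_)
  · have := ((ha j).cos.mul_const (p.1 j)).add ((ha j).sin.mul_const (p.2 j))
    refine this.congr_deriv ?_
    simp only [intFlow, rot, Pi.smul_apply, smul_eq_mul]; ring
  · have := ((ha j).cos.mul_const (p.2 j)).sub ((ha j).sin.mul_const (p.1 j))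
    refine this.congr_deriv ?_
    simp only [intFlow, rot, Pi.smul_apply, smul_eq_mul]; ring

/-- `Q` is a smooth symplectic diffeomorphism. -/
structure IsSymp (Q : Equiv.Perm (Ph d)) : Prop where
  contDiff : ContDiff ℝ (⊤ : ℕ∞) Q
  contDiff_symm : ContDiff ℝ (⊤ : ℕ∞) Q.symm
  symp : ∀ p u v, sympForm (fderiv ℝ Q p u) (fderiv ℝ Q p v) = sympForm u v

lemma IsSymp.one : IsSymp (1 : Equiv.Perm (Ph d)) where
  contDiff := contDiff_id
  contDiff_symm := contDiff_id
  symp p u v := by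
    have : ((1 : Equiv.Perm (Ph d)) : Ph d → Ph d) = id := rfl
    rw [this, fderiv_id]; rfl

lemma IsSymp.mul {Q R : Equiv.Perm (Ph d)} (hQ : IsSymp Q) (hR : IsSymp R) : IsSymp (Q * R) where
  contDiff := hQ.contDiff.comp hR.contDiff
  contDiff_symm := hR.contDiff_symm.comp hQ.contDiff_symm
  symp p u v := by
    rw [show ((Q * R : Equiv.Perm (Ph d)) : Ph d → Ph d) = Q ∘ R from rfl,
      fderiv_comp _ (hQ.contDiff.differentiable (by simp) _)
        (hR.contDiff.differentiable (by simp) _)]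
    simp only [ContinuousLinearMap.comp_apply]
    rw [hQ.symp, hR.symp]

lemma IsSymp.pow {Q : Equiv.Perm (Ph d)} (hQ : IsSymp Q) (n : ℕ) : IsSymp (Q ^ n) := by
  induction n with
  | zero => exact IsSymp.one
  | succ n ih => exact pow_succ Q n ▸ ih.mul hQ

lemma IsSymp.fderiv_hamVF {Q : Equiv.Perm (Ph d)} (hQ : IsSymp Q) {L : Ph d → ℝ}
    (hL : Differentiable ℝ L) (q : Ph d) :
    fderiv ℝ Q q (hamVF L q) = hamVF (fun p => L (Q.symm p)) (Q q) := by
  have hd : Differentiable ℝ Q := hQ.contDiff.differentiable (by simp)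
  have hd' : Differentiable ℝ Q.symm := hQ.contDiff_symm.differentiable (by simp)
  have hinv : ∀ v, fderiv ℝ Q q (fderiv ℝ Q.symm (Q q) v) = v := by
    intro v
    have h1 : HasFDerivAt Q (fderiv ℝ Q q) (Q.symm (Q q)) := by
      rw [Q.symm_apply_apply]; exact (hd q).hasFDerivAt
    have h := (h1.comp (Q q) (hd' (Q q)).hasFDerivAt).unique
      ((hasFDerivAt_id (Q q)).congr_of_eventuallyEq (.of_forall fun x => Q.apply_symm_apply x))
    simpa using DFunLike.congr_fun h v
  refine eq_of_sympForm_eq fun v => ?_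
  rw [sympForm_hamVF, ← hinv v, hQ.symp, sympForm_hamVF, hinv v]
  have h1 : HasFDerivAt L (fderiv ℝ L q) (Q.symm (Q q)) := by
    rw [Q.symm_apply_apply]; exact (hL q).hasFDerivAt
  exact (DFunLike.congr_fun (h1.comp (Q q) (hd' (Q q)).hasFDerivAt).fderiv v).symm

/-- The integrable flow of `ℓ ∘ actV` conjugated by `Q`. -/
def conjFlow (Q : Equiv.Perm (Ph d)) (ℓ : (Fin d → ℝ) → ℝ) (t : ℝ) (p : Ph d) : Ph d :=
  Q (intFlow ℓ t (Q.symm p))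

/-- The Hamiltonian generating `conjFlow`. -/
def conjHam (Q : Equiv.Perm (Ph d)) (ℓ : (Fin d → ℝ) → ℝ) (p : Ph d) : ℝ := ℓ (actV (Q.symm p))

lemma isGlobalFlow_conjFlow {Q : Equiv.Perm (Ph d)} (hQ : IsSymp Q) {ℓ : (Fin d → ℝ) → ℝ}
    (hℓ : ContDiff ℝ (⊤ : ℕ∞) ℓ) : IsGlobalFlow (conjHam Q ℓ) (conjFlow Q ℓ) := by
  refine ⟨fun p => ?_, fun s t p => ?_, fun p t => ?_⟩
  · simp [conjFlow, intFlow, rot_zero]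
  · simp [conjFlow, intFlow_add]
  · have hL : Differentiable ℝ fun q : Ph d => ℓ (actV q) :=
      (hℓ.comp contDiff_actV).differentiable (by simp)
    have h := ((hQ.contDiff.differentiable (by simp)
      (intFlow ℓ t (Q.symm p))).hasFDerivAt.comp_hasDerivAt t (hasDerivAt_intFlow hℓ t (Q.symm p)))
    rw [hQ.fderiv_hamVF hL] at h
    exact h

lemma contDiff_conjHam {Q : Equiv.Perm (Ph d)} (hQ : IsSymp Q) {ℓ : (Fin d → ℝ) → ℝ}
    (hℓ : ContDiff ℝ (⊤ : ℕ∞) ℓ) : ContDiff ℝ (⊤ : ℕ∞) (conjHam Q ℓ) :=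
  hℓ.comp (contDiff_actV.comp hQ.contDiff_symm)

open scoped NNReal

lemma isUnit_one_add_of_norm_lt {E : Type*} [NormedAddCommGroup E] [NormedSpace ℝ E]
    [CompleteSpace E] {A : E →L[ℝ] E} (hA : ‖A‖ < 1) : IsUnit (1 + A) :=
  ⟨Units.oneSub (-A) (by rwa [norm_neg]), by simp⟩

/-- A smooth map that differs from the identity by a contraction is a diffeomorphism. -/
lemma exists_perm_id_add {E : Type*} [NormedAddCommGroup E] [NormedSpace ℝ E]
    [CompleteSpace E] {Y : E → E} (hY : ContDiff ℝ (⊤ : ℕ∞) Y) {c : ℝ≥0}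
    (hc : c < 1) (hL : LipschitzWith c Y) :
    ∃ P : Equiv.Perm E, (∀ m, P m = m + Y m) ∧ ContDiff ℝ (⊤ : ℕ∞) P ∧
      ContDiff ℝ (⊤ : ℕ∞) P.symm := by
  have happ : ApproximatesLinearOn (fun m => m + Y m)
      ((ContinuousLinearEquiv.refl ℝ E : E ≃L[ℝ] E) : E →L[ℝ] E) univ c := by
    intro x _ y _
    have := hL.dist_le_mul x y
    rw [dist_eq_norm, dist_eq_norm] at this
    have h2 : x + Y x - (y + Y y) - (x - y) = Y x - Y y := by abel
    rw [← h2] at this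
    exact this
  have hc' : Subsingleton E ∨
      c < ‖((ContinuousLinearEquiv.refl ℝ E).symm : E →L[ℝ] E)‖₊⁻¹ := by
    rcases subsingleton_or_nontrivial E with h | h
    · exact Or.inl h
    · right
      have : ‖((ContinuousLinearEquiv.refl ℝ E).symm : E →L[ℝ] E)‖₊ = 1 :=
        NNReal.eq ContinuousLinearMap.norm_id
      rwa [this, inv_one]
  let P := happ.toHomeomorph _ hc'
  have hP : ContDiff ℝ (⊤ : ℕ∞) P := contDiff_id.add hY
  have hu : ∀ m, IsUnit (1 + fderiv ℝ Y m) := fun m => isUnit_one_add_of_norm_lt <|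
    lt_of_le_of_lt (norm_fderiv_le_of_lipschitz ℝ hL) (by exact_mod_cast hc)
  refine ⟨P.toEquiv, fun m => rfl, hP, ?_⟩
  refine P.contDiff_symm
    (f₀' := fun m => ContinuousLinearEquiv.unitsEquiv ℝ E (hu m).unit) (fun m => ?_) hP
  exact (hasFDerivAt_id m).add (hY.differentiable (by simp) m).hasFDerivAt

lemma sympForm_fderiv_hamVF {f : Ph d → ℝ} (hf : ContDiff ℝ (⊤ : ℕ∞) f) (m u v : Ph d) :
    sympForm (fderiv ℝ (hamVF f) m u) v + sympForm u (fderiv ℝ (hamVF f) m v) = 0 := by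
  have hd : Differentiable ℝ (fderiv ℝ f) :=
    (hf.fderiv_right (m := (⊤ : ℕ∞)) (by simp)).differentiable (by simp)
  have h1 : ∀ u v, sympForm (fderiv ℝ (hamVF f) m u) v = fderiv ℝ (fderiv ℝ f) m u v := by
    intro u v
    have : fderiv ℝ (hamVF f) m = (hamL d).comp (fderiv ℝ (fderiv ℝ f) m) :=
      ((hamL d).hasFDerivAt.comp m (hd m).hasFDerivAt).fderiv
    rw [this]
    have key : ∀ A : Ph d →L[ℝ] ℝ, sympForm (hamL d A) v = A v := by
      intro A
      have := sympForm_hamVF A 0 v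
      rwa [hamVF_eq, ContinuousLinearMap.fderiv] at this
    exact key _
  rw [h1, sympForm_swap, h1]
  have hs : IsSymmSndFDerivAt ℝ f m :=
    hf.contDiffAt.isSymmSndFDerivAt (by
      rw [minSmoothness_of_isRCLikeNormedField]; exact WithTop.coe_le_coe.2 le_top)
  rw [hs.eq u v]; ring

/-- The implicit midpoint map of a compactly supported Hamiltonian vector field. -/
lemma exists_midpoint_map {f : Ph d → ℝ} (hf : ContDiff ℝ (⊤ : ℕ∞) f) (hs : HasCompactSupport f) :
    ∃ (C : ℝ≥0) (ε : ℝ) (U : Equiv.Perm (Ph d)), 0 < ε ∧ LipschitzWith C (hamVF f) ∧ ε * C < 1 ∧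
      IsSymp U ∧ (∀ m, U (m - ε • hamVF f m) = m + ε • hamVF f m) ∧
      ∀ z, ∃ m, z = m - ε • hamVF f m ∧ ∀ s : Set (Ph d), IsClosed s → z ∈ s →
        (∀ m' ∈ s, z + ε • hamVF f m' ∈ s) → m ∈ s := by
  have hX := contDiff_hamVF hf
  have hsX : HasCompactSupport (hamVF f) :=
    (hs.fderiv (𝕜 := ℝ)).comp_left (g := hamL d) (map_zero _)
  obtain ⟨C, hC⟩ := hX.lipschitzWith_of_hasCompactSupport hsX (by simp)
  set ε : ℝ≥0 := (C + 1)⁻¹ with hε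
  have hε0 : 0 < ε := by positivity
  have hc : ε * C < 1 := by
    rw [hε, inv_mul_lt_iff₀ (by positivity)]; simp
  have hLp : LipschitzWith (ε * C) fun m => (ε : ℝ) • hamVF f m := by
    refine LipschitzWith.of_dist_le_mul fun x y => ?_
    rw [dist_smul₀, NNReal.coe_mul, mul_assoc]
    simpa using mul_le_mul_of_nonneg_left (hC.dist_le_mul x y) ε.2
  have hLn : LipschitzWith (ε * C) fun m => -((ε : ℝ) • hamVF f m) := hLp.neg
  have hYp : ContDiff ℝ (⊤ : ℕ∞) fun m => (ε : ℝ) • hamVF f m := hX.const_smul (ε : ℝ)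
  obtain ⟨P, hP, hPs, hPi⟩ := exists_perm_id_add hYp hc hLp
  obtain ⟨R, hR, hRs, hRi⟩ := exists_perm_id_add hYp.neg hc hLn
  have hU : ∀ m, (R.symm.trans P) (m - (ε : ℝ) • hamVF f m) = m + (ε : ℝ) • hamVF f m := by
    intro m
    rw [sub_eq_add_neg, ← hR m, Equiv.trans_apply, R.symm_apply_apply, hP]
  refine ⟨C, ε, R.symm.trans P, hε0, hC, by exact_mod_cast hc, ⟨hPs.comp hRi, hRs.comp hPi, ?_⟩,
    hU, fun z => ⟨R.symm z, ?_, ?_⟩⟩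
  · intro p u v
    obtain ⟨m, rfl⟩ := R.surjective p
    have hXd := (hX.differentiable (by simp) m).hasFDerivAt.const_smul (ε : ℝ)
    have hPd : HasFDerivAt P _ m :=
      ((hasFDerivAt_id m).add hXd).congr_of_eventuallyEq (.of_forall hP)
    have hRd : HasFDerivAt R _ m :=
      ((hasFDerivAt_id m).add hXd.neg).congr_of_eventuallyEq (.of_forall hR)
    have hUd : HasFDerivAt (R.symm.trans P) (fderiv ℝ (R.symm.trans P) (R m)) (R m) :=
      ((hPs.comp hRi).differentiable (by simp) (R m)).hasFDerivAt
    have hcomp := (hUd.comp m hRd).unique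
      (hPd.congr_of_eventuallyEq (.of_forall fun x => by simp))
    have hsurj : ∀ u : Ph d, ∃ u', (ContinuousLinearMap.id ℝ (Ph d) +
        -((ε : ℝ) • fderiv ℝ (hamVF f) m)) u' = u := by
      have hn : ‖-((ε : ℝ) • fderiv ℝ (hamVF f) m)‖ < 1 := by
        have := norm_fderiv_le_of_lipschitz ℝ (x₀ := m) hLn
        rw [← hXd.neg.fderiv]
        exact lt_of_le_of_lt this (by exact_mod_cast hc)
      intro u
      obtain ⟨w, hw⟩ := isUnit_one_add_of_norm_lt hn
      refine ⟨w.inv u, ?_⟩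
      have := congrArg (fun A => A u) w.mul_inv
      rw [hw] at this
      exact this
    obtain ⟨u, rfl⟩ := hsurj u
    obtain ⟨v, rfl⟩ := hsurj v
    have hcv : ∀ x, _ = _ := fun x => DFunLike.congr_fun hcomp x
    simp only [ContinuousLinearMap.comp_apply] at hcv
    rw [hcv, hcv]
    have h0 := sympForm_fderiv_hamVF hf m u v
    simp only [add_apply, neg_apply,
      smul_apply, ContinuousLinearMap.coe_id', id, ← neg_smul,
      sympForm_add_left, sympForm_add_right, sympForm_smul_left, sympForm_smul_right]
    linear_combination 2 * (ε : ℝ) * h0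
  · conv_lhs => rw [← R.apply_symm_apply z, hR]
    rw [sub_eq_add_neg]
  · intro s hsc hz hmaps
    have hLz : LipschitzWith (ε * C) fun m => z + (ε : ℝ) • hamVF f m :=
      LipschitzWith.of_dist_le_mul fun x y => by
        rw [dist_add_left]; exact hLp.dist_le_mul x y
    have hmt : MapsTo (fun m => z + (ε : ℝ) • hamVF f m) s s := hmaps
    obtain ⟨y, hys, hy, -⟩ := ContractingWith.exists_fixedPoint' hsc.isComplete hmt
      ⟨hc, LipschitzWith.of_dist_le_mul fun x y => hLz.dist_le_mul x y⟩ hz (edist_ne_top _ _)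
    have : R y = z := by
      rw [hR]; nth_rewrite 1 [← hy.eq]; abel
    rwa [← this, R.symm_apply_apply]

/-- The monomial `z_a ^ P * w_j ^ N`, where `z = x + i y` and `w = x + i σ y`. -/
def resMon (a j : Fin d) (σ : ℝ) (P N : ℕ) (m : Ph d) : ℂ :=
  (⟨m.1 a, m.2 a⟩ : ℂ) ^ P * (⟨m.1 j, σ * m.2 j⟩ : ℂ) ^ N

/-- The integer vector of the resonance satisfied by `resMon`. -/
def resVec (a j : Fin d) (σ : ℝ) (P N : ℕ) : Fin d → ℝ :=
  Pi.single a (P : ℝ) + Pi.single j (σ * N)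

/-- Rescale the `i`-th plane by `μ i`. -/
def scl (μ : Fin d → ℝ) (z : Ph d) : Ph d := (fun i => μ i * z.1 i, fun i => μ i * z.2 i)

lemma actJ_scl (μ : Fin d → ℝ) (z : Ph d) (i : Fin d) :
    actJ i (scl μ z) = μ i ^ 2 * actJ i z := by
  simp only [actJ, scl]; ring

lemma resMon_scl (a j : Fin d) (σ : ℝ) (P N : ℕ) (μ : Fin d → ℝ) (z : Ph d) :
    resMon a j σ P N (scl μ z) = ((μ a ^ P * μ j ^ N : ℝ) : ℂ) * resMon a j σ P N z := by
  have h1 : (⟨(scl μ z).1 a, (scl μ z).2 a⟩ : ℂ) = (μ a : ℂ) * ⟨z.1 a, z.2 a⟩ := by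
    apply Complex.ext <;> simp [scl]
  have h2 : (⟨(scl μ z).1 j, σ * (scl μ z).2 j⟩ : ℂ) = (μ j : ℂ) * ⟨z.1 j, σ * z.2 j⟩ := by
    apply Complex.ext <;> simp [scl]; ring
  rw [resMon, h1, h2, resMon, mul_pow, mul_pow]
  push_cast
  ring

lemma resMon_ne_zero {a j : Fin d} {σ : ℝ} (hσ : σ ^ 2 = 1) (P N : ℕ) {z : Ph d}
    (ha : actJ a z ≠ 0) (hj : actJ j z ≠ 0) : resMon a j σ P N z ≠ 0 := by
  have hσ0 : σ ≠ 0 := by rintro rfl; norm_num at hσ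
  refine mul_ne_zero (pow_ne_zero _ fun h => ha ?_) (pow_ne_zero _ fun h => hj ?_)
  · rw [Complex.ext_iff] at h
    exact actJ_eq_zero.2 h
  · rw [Complex.ext_iff] at h
    exact actJ_eq_zero.2 ⟨h.1, (mul_eq_zero.1 h.2).resolve_left hσ0⟩

lemma resMon_rot {a j : Fin d} {σ : ℝ} (hσ : σ = 1 ∨ σ = -1) (P N : ℕ) (ν : Fin d → ℝ) (m : Ph d) :
    resMon a j σ P N (rot ν m) =
      Complex.exp (-((P * ν a + σ * N * ν j : ℝ) : ℂ) * Complex.I) * resMon a j σ P N m := by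
  have h1 : (⟨(rot ν m).1 a, (rot ν m).2 a⟩ : ℂ) =
      Complex.exp (-(ν a : ℂ) * Complex.I) * ⟨m.1 a, m.2 a⟩ := by
    rw [Complex.exp_mul_I]
    apply Complex.ext <;>
      simp [rot, ← Complex.ofReal_cos, ← Complex.ofReal_sin]
    ring
  have h2 : (⟨(rot ν m).1 j, σ * (rot ν m).2 j⟩ : ℂ) =
      Complex.exp (-((σ * ν j : ℝ) : ℂ) * Complex.I) * ⟨m.1 j, σ * m.2 j⟩ := by
    rw [Complex.exp_mul_I]
    rcases hσ with rfl | rfl <;> apply Complex.ext <;>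
      simp [rot, ← Complex.ofReal_cos, ← Complex.ofReal_sin] <;> ring
  rw [resMon, h1, h2, resMon, mul_pow, mul_pow, ← Complex.exp_nat_mul, ← Complex.exp_nat_mul]
  rw [show ∀ A B C D : ℂ, A * B * (C * D) = (A * C) * (B * D) from fun A B C D => by ring,
    ← Complex.exp_add]
  congr 2
  push_cast
  ring

lemma contDiff_resMon_re (a j : Fin d) (σ : ℝ) (P N : ℕ) :
    ContDiff ℝ (⊤ : ℕ∞) fun m : Ph d => (resMon a j σ P N m).re := by
  have hmk : ∀ u v : Ph d → ℝ, ContDiff ℝ (⊤ : ℕ∞) u → ContDiff ℝ (⊤ : ℕ∞) v →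
      ContDiff ℝ (⊤ : ℕ∞) fun m => (⟨u m, v m⟩ : ℂ) := fun u v hu hv =>
    Complex.equivRealProdCLM.symm.contDiff.comp (hu.prodMk hv)
  have h : ContDiff ℝ (⊤ : ℕ∞) fun m : Ph d => resMon a j σ P N m :=
    ((hmk _ _ (by fun_prop) (by fun_prop)).pow P).mul
    ((hmk _ _ (by fun_prop) (by fun_prop)).pow N)
  exact Complex.reCLM.contDiff.comp h

lemma continuous_resMon (a j : Fin d) (σ : ℝ) (P N : ℕ) :
    Continuous fun m : Ph d => resMon a j σ P N m := by
  have hmk : ∀ u v : Ph d → ℝ, Continuous u → Continuous v →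
      Continuous fun m => (⟨u m, v m⟩ : ℂ) := fun u v hu hv =>
    Complex.equivRealProdCLM.symm.continuous.comp (hu.prodMk hv)
  exact ((hmk _ _ (by fun_prop) (by fun_prop)).pow P).mul
    ((hmk _ _ (by fun_prop) (by fun_prop)).pow N)

/-- The resonant Hamiltonian with action-dependent amplitude `η`. -/
def resHam (η : (Fin d → ℝ) → ℝ) (a j : Fin d) (σ : ℝ) (P N : ℕ) (m : Ph d) : ℝ :=
  η (actV m) * (resMon a j σ P N m).re

lemma contDiff_resHam {η : (Fin d → ℝ) → ℝ} (hη : ContDiff ℝ (⊤ : ℕ∞) η) (a j : Fin d) (σ : ℝ)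
    (P N : ℕ) : ContDiff ℝ (⊤ : ℕ∞) (resHam η a j σ P N) :=
  (hη.comp contDiff_actV).mul (contDiff_resMon_re a j σ P N)

lemma hasDerivAt_rot_single (i : Fin d) (m : Ph d) :
    HasDerivAt (fun t : ℝ => rot (Pi.single i t) m)
      (Pi.single i (m.2 i), -Pi.single i (m.1 i)) 0 := by
  have hs : ∀ l, HasDerivAt (fun t : ℝ => (Pi.single i t : Fin d → ℝ) l)
      ((Pi.single i 1 : Fin d → ℝ) l) 0 := by
    intro l
    rcases eq_or_ne l i with rfl | h
    · simpa using hasDerivAt_id' (0 : ℝ)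
    · simpa [h] using hasDerivAt_const (0 : ℝ) (0 : ℝ)
  refine HasDerivAt.prodMk (hasDerivAt_pi.2 fun l => ?_) (hasDerivAt_pi.2 fun l => ?_)
  · refine (((hs l).cos.mul_const (m.1 l)).add ((hs l).sin.mul_const (m.2 l))).congr_deriv ?_
    rcases eq_or_ne l i with rfl | h <;> simp [*]
  · refine (((hs l).cos.mul_const (m.2 l)).sub ((hs l).sin.mul_const (m.1 l))).congr_deriv ?_
    rcases eq_or_ne l i with rfl | h <;> simp [*]

lemma fderiv_resHam_rot {η : (Fin d → ℝ) → ℝ} (hη : ContDiff ℝ (⊤ : ℕ∞) η) {a j : Fin d} {σ : ℝ}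
    (hσ : σ = 1 ∨ σ = -1) (P N : ℕ) (i : Fin d) (m : Ph d) :
    fderiv ℝ (resHam η a j σ P N) m (Pi.single i (m.2 i), -Pi.single i (m.1 i)) =
      resVec a j σ P N i * (η (actV m) * (resMon a j σ P N m).im) := by
  have hd := ((contDiff_resHam hη a j σ P N).differentiable (by simp)
    (rot (Pi.single i 0) m)).hasFDerivAt
  have h1 := hd.comp_hasDerivAt (0 : ℝ) (hasDerivAt_rot_single i m)
  rw [Pi.single_zero, rot_zero] at h1
  set k := resVec a j σ P N i with hk
  have hang : ∀ t : ℝ, P * (Pi.single i t : Fin d → ℝ) a + σ * N * (Pi.single i t : Fin d → ℝ) j =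
      k * t := by
    intro t
    simp only [hk, resVec, Pi.add_apply, Pi.single_apply, eq_comm (a := i)]
    split_ifs <;> ring
  have h2 : (fun t : ℝ => resHam η a j σ P N (rot (Pi.single i t) m)) = fun t =>
      η (actV m) * (Real.cos (k * t) * (resMon a j σ P N m).re +
        Real.sin (k * t) * (resMon a j σ P N m).im) := by
    funext t
    rw [resHam, actV_rot, resMon_rot hσ, hang]
    congr 1
    rw [← Complex.ofReal_neg, Complex.mul_re, Complex.exp_ofReal_mul_I_re,
      Complex.exp_ofReal_mul_I_im, Real.cos_neg, Real.sin_neg]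
    ring
  have hkt : HasDerivAt (fun t : ℝ => k * t) k 0 := by
    simpa using (hasDerivAt_id (0 : ℝ)).const_mul k
  have h3 := ((hkt.cos.mul_const (resMon a j σ P N m).re).add
    (hkt.sin.mul_const (resMon a j σ P N m).im)).const_mul (η (actV m))
  have h4 := h1.unique (h3.congr_of_eventuallyEq (.of_forall fun t => congrFun h2 t))
  rw [h4]
  simp
  ring

lemma hamVF_dot (f : Ph d → ℝ) (i : Fin d) (m : Ph d) :
    m.1 i * (hamVF f m).1 i + m.2 i * (hamVF f m).2 i =
      -fderiv ℝ f m (Pi.single i (m.2 i), -Pi.single i (m.1 i)) := by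
  have : ((Pi.single i (m.2 i), -Pi.single i (m.1 i)) : Ph d) =
      m.2 i • ((Pi.single i 1, 0) : Ph d) - m.1 i • ((0, Pi.single i 1) : Ph d) := by
    refine Prod.ext (funext fun l => ?_) (funext fun l => ?_) <;> simp [Pi.single_apply]
  rw [this, map_sub, map_smul, map_smul]
  simp [hamVF]
  ring

lemma hamVF_cross (f : Ph d → ℝ) (i : Fin d) (m z : Ph d) :
    (hamVF f m).1 i * z.2 i - (hamVF f m).2 i * z.1 i =
      fderiv ℝ f m (Pi.single i (z.1 i), Pi.single i (z.2 i)) := by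
  have : ((Pi.single i (z.1 i), Pi.single i (z.2 i)) : Ph d) =
      z.1 i • ((Pi.single i 1, 0) : Ph d) + z.2 i • ((0, Pi.single i 1) : Ph d) := by
    refine Prod.ext (funext fun l => ?_) (funext fun l => ?_) <;> simp [Pi.single_apply]
  rw [this, map_add, map_smul, map_smul]
  simp [hamVF]
  ring

/-- Points whose planar components are parallel to those of `z`. -/
def parSet (z : Ph d) : Set (Ph d) := {m | ∀ i, m.1 i * z.2 i = m.2 i * z.1 i}

lemma isClosed_parSet (z : Ph d) : IsClosed (parSet z) := by
  simp only [parSet, ofPred_forall]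
  exact isClosed_iInter fun i => isClosed_eq (by fun_prop) (by fun_prop)

lemma exists_scl_of_mem_parSet {z m : Ph d} (hz : ∀ i, actJ i z ≠ 0) (hm : m ∈ parSet z) :
    ∃ μ, m = scl μ z := by
  have : ∀ i, ∃ c : ℝ, m.1 i = c * z.1 i ∧ m.2 i = c * z.2 i := by
    intro i
    have h := hm i
    by_cases h1 : z.1 i = 0
    · have h2 : z.2 i ≠ 0 := fun h2 => hz i (actJ_eq_zero.2 ⟨h1, h2⟩)
      refine ⟨m.2 i / z.2 i, ?_, by field_simp⟩
      rw [h1, mul_zero] at h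
      rw [h1, mul_zero]
      exact (mul_eq_zero.1 h).resolve_right h2
    · refine ⟨m.1 i / z.1 i, by field_simp, ?_⟩
      field_simp
      linarith
  choose μ h1 h2 using this
  exact ⟨μ, Prod.ext (funext h1) (funext h2)⟩

lemma hamVF_mem_parSet {f : Ph d → ℝ} (hf : ContDiff ℝ (⊤ : ℕ∞) f) {z : Ph d}
    (h0 : ∀ m ∈ parSet z, f m = 0) {m : Ph d} (hm : m ∈ parSet z) : hamVF f m ∈ parSet z := by
  intro i
  rw [← sub_eq_zero, hamVF_cross]
  have hline : HasDerivAt (fun t : ℝ => m + t • ((Pi.single i (z.1 i), Pi.single i (z.2 i)) : Ph d))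
      (Pi.single i (z.1 i), Pi.single i (z.2 i)) 0 := by
    simpa using ((hasDerivAt_id (0 : ℝ)).smul_const
      ((Pi.single i (z.1 i), Pi.single i (z.2 i)) : Ph d)).const_add m
  have hd := (hf.differentiable (by simp)
    (m + (0 : ℝ) • ((Pi.single i (z.1 i), Pi.single i (z.2 i)) : Ph d))).hasFDerivAt
  have h1 := hd.comp_hasDerivAt (0 : ℝ) hline
  rw [zero_smul, add_zero] at h1
  refine h1.unique ((hasDerivAt_const (0 : ℝ) (0 : ℝ)).congr_of_eventuallyEq
    (.of_forall fun t => h0 _ fun l => ?_))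
  have := hm l
  rcases eq_or_ne l i with rfl | h
  · simp; linarith
  · simpa [h] using this

lemma actJ_add_sub (i : Fin d) (m v : Ph d) :
    actJ i (m + v) - actJ i (m - v) = 2 * (m.1 i * v.1 i + m.2 i * v.2 i) := by
  simp only [actJ, Prod.fst_add, Prod.snd_add, Prod.fst_sub, Prod.snd_sub, Pi.add_apply,
    Pi.sub_apply]
  ring

lemma actJ_midpoint_resHam {η : (Fin d → ℝ) → ℝ} (hη : ContDiff ℝ (⊤ : ℕ∞) η) {a j : Fin d}
    {σ : ℝ} (hσ : σ = 1 ∨ σ = -1) (P N : ℕ) (ε : ℝ) (i : Fin d) (m : Ph d) :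
    actJ i (m + ε • hamVF (resHam η a j σ P N) m) -
      actJ i (m - ε • hamVF (resHam η a j σ P N) m) =
      -(2 * ε * resVec a j σ P N i * (η (actV m) * (resMon a j σ P N m).im)) := by
  rw [actJ_add_sub]
  have h := hamVF_dot (resHam η a j σ P N) i m
  rw [fderiv_resHam_rot hη hσ] at h
  simp only [Prod.smul_fst, Prod.smul_snd, Pi.smul_apply, smul_eq_mul]
  linear_combination 2 * ε * h

lemma pos_of_contraction {μ ξ ε C : ℝ} (h1 : 1 = μ - ε * ξ) (hε : 0 < ε) (hC : ε * C < 1)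
    (hξ : |ξ| ≤ C * |μ|) : 0 < μ ∧ 0 < μ + ε * ξ := by
  have hμ : μ ≠ 0 := by
    rintro rfl
    rw [abs_zero, mul_zero] at hξ
    rw [abs_nonpos_iff.1 hξ] at h1
    norm_num at h1
  have h2 : |ε * ξ| < |μ| := by
    rw [abs_mul, abs_of_pos hε]
    have := abs_pos.2 hμ
    nlinarith
  rcases lt_or_gt_of_ne hμ with h | h
  · rw [abs_of_neg h, abs_lt] at h2
    linarith [h2.1]
  · rw [abs_of_pos h, abs_lt] at h2
    exact ⟨h, by linarith [h2.1]⟩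

/-- On the invariant plane `Re resMon = 0` the midpoint map only rescales the planar components. -/
lemma midpoint_resHam_eq_scl {η : (Fin d → ℝ) → ℝ} (hη : ContDiff ℝ (⊤ : ℕ∞) η) {a j : Fin d}
    {σ : ℝ} (hσ : σ = 1 ∨ σ = -1) {P N : ℕ}
    (hax : ∀ m : Ph d, (∃ i, actJ i m = 0) → hamVF (resHam η a j σ P N) m = 0)
    {C : ℝ≥0} {ε : ℝ} {U : Equiv.Perm (Ph d)} (hε : 0 < ε)
    (hC : LipschitzWith C (hamVF (resHam η a j σ P N))) (hεC : ε * C < 1)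
    (hU : ∀ m, U (m - ε • hamVF (resHam η a j σ P N) m) = m + ε • hamVF (resHam η a j σ P N) m)
    (hm : ∀ z, ∃ m, z = m - ε • hamVF (resHam η a j σ P N) m ∧ ∀ s : Set (Ph d), IsClosed s →
      z ∈ s → (∀ m' ∈ s, z + ε • hamVF (resHam η a j σ P N) m' ∈ s) → m ∈ s)
    {z : Ph d} (hz : ∀ i, actJ i z ≠ 0) (hre : (resMon a j σ P N z).re = 0) :
    ∃ μ c : Fin d → ℝ, (∀ i, 0 < μ i ∧ 0 < c i ∧ 2 * μ i = 1 + c i) ∧ U z = scl c z ∧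
      ∀ i, actJ i (U z) - actJ i z = -(2 * ε * resVec a j σ P N i *
        (η (actV (scl μ z)) * (resMon a j σ P N (scl μ z)).im)) := by
  set f := resHam η a j σ P N with hf
  have hfs : ContDiff ℝ (⊤ : ℕ∞) f := contDiff_resHam hη a j σ P N
  have h0 : ∀ m ∈ parSet z, f m = 0 := by
    intro m hmz
    obtain ⟨μ, rfl⟩ := exists_scl_of_mem_parSet hz hmz
    rw [hf, resHam, resMon_scl, Complex.re_ofReal_mul, hre, mul_zero, mul_zero]
  obtain ⟨m, hzm, hcl⟩ := hm z
  have hmz : m ∈ parSet z := by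
    refine hcl _ (isClosed_parSet z) (fun i => mul_comm _ _) fun m' hm' i => ?_
    have := hamVF_mem_parSet hfs h0 hm' i
    simp only [Prod.fst_add, Prod.snd_add, Prod.smul_fst, Prod.smul_snd, Pi.add_apply,
      Pi.smul_apply, smul_eq_mul]
    linear_combination ε * this
  obtain ⟨μ, hμ⟩ := exists_scl_of_mem_parSet hz hmz
  obtain ⟨ξ, hξ⟩ := exists_scl_of_mem_parSet hz (hamVF_mem_parSet hfs h0 hmz)
  have hUz : U z = m + ε • hamVF f m := by conv_lhs => rw [hzm, hU]
  have hpos : ∀ i, 1 = μ i - ε * ξ i ∧ 0 < μ i ∧ 0 < μ i + ε * ξ i := by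
    intro i
    have e1 : z.1 i = μ i * z.1 i - ε * (ξ i * z.1 i) := by
      have := congrFun (congrArg Prod.fst hzm) i
      rw [hξ, hμ] at this
      simpa [scl] using this
    have e2 : z.2 i = μ i * z.2 i - ε * (ξ i * z.2 i) := by
      have := congrFun (congrArg Prod.snd hzm) i
      rw [hξ, hμ] at this
      simpa [scl] using this
    have hzi : z.1 i ≠ 0 ∨ z.2 i ≠ 0 := by
      by_contra! h
      exact hz i (actJ_eq_zero.2 h)
    have e3 : 1 = μ i - ε * ξ i := by
      rcases hzi with h | h
      · exact mul_right_cancel₀ h (by linear_combination e1)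
      · exact mul_right_cancel₀ h (by linear_combination e2)
    refine ⟨e3, pos_of_contraction e3 hε hεC ?_⟩
    set M := max |z.1 i| |z.2 i| with hM
    have hMpos : 0 < M := by
      rcases hzi with h | h
      · exact lt_max_of_lt_left (abs_pos.2 h)
      · exact lt_max_of_lt_right (abs_pos.2 h)
    set m₀ : Ph d := (Function.update m.1 i 0, Function.update m.2 i 0) with hm₀
    have hX0 : hamVF f m₀ = 0 := hax m₀ ⟨i, actJ_eq_zero.2 ⟨by simp [hm₀], by simp [hm₀]⟩⟩
    have hdist : ‖m - m₀‖ ≤ |μ i| * M := by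
      have hb1 : |μ i| * |z.1 i| ≤ |μ i| * M :=
        mul_le_mul_of_nonneg_left (le_max_left _ _) (abs_nonneg _)
      have hb2 : |μ i| * |z.2 i| ≤ |μ i| * M :=
        mul_le_mul_of_nonneg_left (le_max_right _ _) (abs_nonneg _)
      have hn : 0 ≤ |μ i| * M := by positivity
      refine norm_prod_le_iff.2 ⟨(pi_norm_le_iff_of_nonneg hn).2 fun l => ?_,
        (pi_norm_le_iff_of_nonneg hn).2 fun l => ?_⟩ <;>
      · rcases eq_or_ne l i with rfl | h
        · simpa [hm₀, hμ, scl] using ‹_›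
        · simpa [hm₀, h] using hn
    have hlip : ‖hamVF f m‖ ≤ C * (|μ i| * M) := by
      have := hC.dist_le_mul m m₀
      rw [dist_eq_norm, dist_eq_norm, hX0, sub_zero] at this
      exact this.trans (mul_le_mul_of_nonneg_left hdist C.2)
    rw [hξ] at hlip
    have hb1 : |ξ i| * |z.1 i| ≤ C * (|μ i| * M) := by
      rw [← abs_mul]
      exact (norm_le_pi_norm (scl ξ z).1 i).trans ((norm_fst_le _).trans hlip)
    have hb2 : |ξ i| * |z.2 i| ≤ C * (|μ i| * M) := by
      rw [← abs_mul]
      exact (norm_le_pi_norm (scl ξ z).2 i).trans ((norm_snd_le _).trans hlip)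
    have hb : |ξ i| * M ≤ C * |μ i| * M := by
      rw [hM, mul_max_of_nonneg _ _ (abs_nonneg _), ← hM]
      exact max_le (hb1.trans_eq (by ring)) (hb2.trans_eq (by ring))
    exact le_of_mul_le_mul_right hb hMpos
  refine ⟨μ, fun i => μ i + ε * ξ i, fun i => ⟨(hpos i).2.1, (hpos i).2.2, ?_⟩, ?_, fun i => ?_⟩
  · linear_combination -(hpos i).1
  · rw [hUz, hξ, hμ]
    refine Prod.ext (funext fun i => ?_) (funext fun i => ?_) <;> simp [scl] <;> ring
  · rw [hUz, ← hμ]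
    conv_lhs => rw [hzm]
    exact actJ_midpoint_resHam hη hσ P N ε i m

/-- The compact region `1/(n+1) ≤ r_i ≤ n+1`. -/
def box (d n : ℕ) : Set (Ph d) := {p | ∀ i, 1 / ((n : ℝ) + 1) ≤ actJ i p ∧ actJ i p ≤ n + 1}

lemma continuous_actJ (i : Fin d) : Continuous (actJ i : Ph d → ℝ) := by
  unfold actJ
  fun_prop

lemma isCompact_box (n : ℕ) : IsCompact (box d n) := by
  refine Metric.isCompact_of_isClosed_isBounded ?_ ?_
  · simp only [box, ofPred_forall]
    exact isClosed_iInter fun i => (isClosed_le continuous_const (continuous_actJ i)).inter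
      (isClosed_le (continuous_actJ i) continuous_const)
  · refine (Metric.isBounded_closedBall (x := (0 : Ph d)) (r := 2 * (n + 1))).subset fun p hp => ?_
    have hn : (0 : ℝ) ≤ n := n.cast_nonneg
    rw [mem_closedBall_zero_iff]
    have hb : ∀ i, |p.1 i| ≤ 2 * (n + 1) ∧ |p.2 i| ≤ 2 * (n + 1) := by
      intro i
      have := (hp i).2
      unfold actJ at this
      have h1 : p.1 i ^ 2 ≤ (2 * ((n : ℝ) + 1)) ^ 2 := by nlinarith [sq_nonneg (p.2 i)]
      have h2 : p.2 i ^ 2 ≤ (2 * ((n : ℝ) + 1)) ^ 2 := by nlinarith [sq_nonneg (p.1 i)]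
      exact ⟨abs_le_of_sq_le_sq h1 (by positivity),
        abs_le_of_sq_le_sq h2 (by positivity)⟩
    exact norm_prod_le_iff.2 ⟨(pi_norm_le_iff_of_nonneg (by positivity)).2 fun i => (hb i).1,
      (pi_norm_le_iff_of_nonneg (by positivity)).2 fun i => (hb i).2⟩

lemma box_pos {n : ℕ} {p : Ph d} (hp : p ∈ box d n) (i : Fin d) : 0 < actJ i p :=
  lt_of_lt_of_le (by positivity) (hp i).1

lemma box_subset_succ (n : ℕ) : box d n ⊆ box d (n + 1) := fun p hp i => by
  have h := hp i
  push_cast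
  exact ⟨le_trans (one_div_le_one_div_of_le (by positivity) (by linarith)) h.1, by linarith [h.2]⟩

/-- A point whose actions lie between those of two points of the box is in the box. -/
lemma mem_box_of_between {n : ℕ} {p q z : Ph d} (hp : p ∈ box d n) (hq : q ∈ box d n)
    (h : ∀ i, (actJ i p ≤ actJ i z ∧ actJ i z ≤ actJ i q) ∨
      (actJ i q ≤ actJ i z ∧ actJ i z ≤ actJ i p)) : z ∈ box d n := fun i => by
  rcases h i with h | h
  · exact ⟨(hp i).1.trans h.1, h.2.trans (hq i).2⟩
  · exact ⟨(hq i).1.trans h.1, h.2.trans (hp i).2⟩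

/-- A smooth function of one variable, positive exactly on `(1/(n+2), n+2)`. -/
def bumpFun (n : ℕ) (x : ℝ) : ℝ := expNegInvGlue (x - 1 / (n + 2)) * expNegInvGlue (n + 2 - x)

lemma contDiff_bumpFun (n : ℕ) : ContDiff ℝ (⊤ : ℕ∞) (bumpFun n) :=
  (expNegInvGlue.contDiff.comp (contDiff_id.sub contDiff_const)).mul
    (expNegInvGlue.contDiff.comp (contDiff_const.sub contDiff_id))

lemma bumpFun_nonneg (n : ℕ) (x : ℝ) : 0 ≤ bumpFun n x :=
  mul_nonneg (expNegInvGlue.nonneg _) (expNegInvGlue.nonneg _)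

lemma bumpFun_pos {n : ℕ} {x : ℝ} (h1 : 1 / ((n : ℝ) + 1) ≤ x) (h2 : x ≤ n + 1) :
    0 < bumpFun n x := by
  refine mul_pos (expNegInvGlue.pos_of_pos (sub_pos.2 (lt_of_lt_of_le ?_ h1)))
    (expNegInvGlue.pos_of_pos (by linarith))
  exact one_div_lt_one_div_of_lt (by positivity) (by linarith)

lemma bumpFun_eq_zero {n : ℕ} {x : ℝ} (h : x < 1 / ((n : ℝ) + 2) ∨ n + 2 < x) :
    bumpFun n x = 0 := by
  rcases h with h | h
  · rw [bumpFun, expNegInvGlue.zero_of_nonpos (by linarith), zero_mul]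
  · rw [bumpFun, expNegInvGlue.zero_of_nonpos (x := n + 2 - x) (by linarith), mul_zero]

/-- The amplitude of the resonant Hamiltonian. -/
def amp (κ : ℝ → ℝ) (e : Fin d) (n : ℕ) (r : Fin d → ℝ) : ℝ := κ (r e) * ∏ i, bumpFun n (r i)

lemma contDiff_amp {κ : ℝ → ℝ} (hκ : ContDiff ℝ (⊤ : ℕ∞) κ) (e : Fin d) (n : ℕ) :
    ContDiff ℝ (⊤ : ℕ∞) (amp κ e n) := by
  refine (hκ.comp (contDiff_apply ℝ ℝ e)).mul (contDiff_prod fun i _ => ?_)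
  exact (contDiff_bumpFun n).comp (contDiff_apply ℝ ℝ i)

lemma amp_eq_zero {κ : ℝ → ℝ} {e : Fin d} {n : ℕ} {p : Ph d} (hp : p ∉ box d (n + 1)) :
    amp κ e n (actV p) = 0 := by
  simp only [box, Set.mem_ofPred_eq, not_forall, not_and_or, not_le] at hp
  obtain ⟨i, hi⟩ := hp
  rw [amp, Finset.prod_eq_zero (Finset.mem_univ i), mul_zero]
  have h2 : ((n + 1 : ℕ) : ℝ) + 1 = n + 2 := by push_cast; ring
  rw [h2] at hi
  exact bumpFun_eq_zero hi

lemma mem_box_of_segment {n : ℕ} {k : Fin d → ℝ} {p q z : Ph d} {s t : ℝ} (hp : p ∈ box d n)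
    (hq : q ∈ box d n) (hs : 0 ≤ s) (ht : 0 ≤ t) (h1 : actV z = actV p + s • k)
    (h2 : actV q = actV z + t • k) : z ∈ box d n := by
  refine mem_box_of_between hp hq fun i => ?_
  have e1 := congrFun h1 i
  have e2 := congrFun h2 i
  simp only [actV, Pi.add_apply, Pi.smul_apply, smul_eq_mul] at e1 e2
  rcases le_total 0 (k i) with h | h
  · exact Or.inl ⟨by nlinarith, by nlinarith⟩
  · exact Or.inr ⟨by nlinarith, by nlinarith⟩

/-- Iterating a map that moves the actions in a fixed direction, uniformly inside the box. -/
lemma iterate_drift {n : ℕ} {k : Fin d → ℝ} {e : Fin d} (hk : k e = 0) {κ : ℝ → ℝ} {δ : ℝ}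
    {U : Equiv.Perm (Ph d)} {S : Set (Ph d)}
    (hU : ∀ z ∈ S, U z ∈ S ∧ ∃ s, 0 ≤ s ∧ actV (U z) = actV z + s • k ∧
      (κ (actJ e z) = 1 → z ∈ box d n → U z ∈ box d n → δ ≤ s)) (N : ℕ) {z : Ph d} (hz : z ∈ S) :
    (U ^ N) z ∈ S ∧ ∃ s, 0 ≤ s ∧ actV ((U ^ N) z) = actV z + s • k ∧
      (κ (actJ e z) = 1 → z ∈ box d n → (U ^ N) z ∈ box d n → N * δ ≤ s) := by
  induction N with
  | zero => exact ⟨hz, 0, le_rfl, by simp, fun _ _ _ => by simp⟩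
  | succ N ih =>
    obtain ⟨hS, s, hs, hact, hdr⟩ := ih
    obtain ⟨hS', t, ht, hact', hdr'⟩ := hU _ hS
    rw [pow_succ', Equiv.Perm.mul_apply]
    refine ⟨hS', s + t, add_nonneg hs ht, by rw [hact', hact, add_smul, add_assoc],
      fun h1 h2 h3 => ?_⟩
    have hmid := mem_box_of_segment h2 h3 hs ht hact hact'
    have he : actJ e ((U ^ N) z) = actJ e z := by
      have := congrFun hact e
      simpa [hk, actV] using this
    have := hdr h1 h2 hmid
    have := hdr' (he ▸ h1) hmid h3
    push_cast
    linarith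

lemma exists_amp_lower_bound (e : Fin d) (n : ℕ) (a j : Fin d) {σ : ℝ} (hσ : σ ^ 2 = 1) (P N : ℕ) :
    ∃ c > 0, ∀ κ : ℝ → ℝ, ∀ m ∈ box d n, κ (actJ e m) = 1 →
      c ≤ amp κ e n (actV m) * ‖resMon a j σ P N m‖ := by
  have hcont : Continuous fun m : Ph d =>
      (∏ i, bumpFun n (actV m i)) * ‖resMon a j σ P N m‖ := by
    refine Continuous.mul (continuous_finsetProd _ fun i _ => ?_) (continuous_resMon _ _ _ _ _).norm
    exact (contDiff_bumpFun n).continuous.comp (continuous_actJ i)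
  obtain ⟨c, hc, h⟩ := (isCompact_box (d := d) n).exists_forall_le' (a := 0) hcont.continuousOn
    fun m hm => mul_pos (Finset.prod_pos fun i _ => bumpFun_pos (hm i).1 (hm i).2)
      (norm_pos_iff.2 (resMon_ne_zero hσ P N (box_pos hm a).ne' (box_pos hm j).ne'))
  refine ⟨c, hc, fun κ m hm h1 => ?_⟩
  have h2 : amp κ e n (actV m) = ∏ i, bumpFun n (actV m i) := by
    rw [amp, show κ (actV m e) = 1 from h1, one_mul]
  rw [h2]
  exact h m hm

/-- A symplectic map moving points along the resonance until they leave a given box. -/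
theorem exists_exit_map {a j e : Fin d} (haj : a ≠ j) (hea : e ≠ a) (hej : e ≠ j) {κ : ℝ → ℝ}
    (hκ : ContDiff ℝ (⊤ : ℕ∞) κ) (hκ0 : ∀ x, 0 ≤ κ x) {σ : ℝ} (hσ : σ = 1 ∨ σ = -1) {P N : ℕ}
    (hP : 0 < P) (n : ℕ) :
    ∃ W : Equiv.Perm (Ph d), IsSymp W ∧ (∀ z ∉ box d (n + 1), W z = z) ∧
      (∀ z, ∃ s : ℝ, actV (W z) = actV z + s • resVec a j σ P N ∧
        (s = 0 ∨ actJ e z ∈ tsupport κ)) ∧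
      ∀ q, (∀ i, actJ i q ≠ 0) → κ (actJ e q) = 1 →
        ∃ θ : ℝ, |θ| ≤ 2 * Real.pi ∧
          ∀ ν : Fin d → ℝ, P * ν a + σ * N * ν j = θ → W (rot ν q) ∉ box d n := by
  have hσ2 : σ ^ 2 = 1 := by rcases hσ with rfl | rfl <;> norm_num
  have hη := contDiff_amp hκ e n
  set f := resHam (amp κ e n) a j σ P N with hf
  have hfs : ContDiff ℝ (⊤ : ℕ∞) f := contDiff_resHam hη a j σ P N
  have hf0 : ∀ m ∉ box d (n + 1), f m = 0 := fun m hm => by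
    rw [hf, resHam, amp_eq_zero hm, zero_mul]
  have hX0 : ∀ m, f =ᶠ[𝓝 m] 0 → hamVF f m = 0 := fun m hm => by
    rw [hamVF_eq, hm.fderiv_eq, show fderiv ℝ (0 : Ph d → ℝ) m = 0 from fderiv_const_apply 0,
      map_zero]
  have hXbox : ∀ m ∉ box d (n + 1), hamVF f m = 0 := fun m hm => by
    refine hX0 m ?_
    filter_upwards [(isCompact_box (n + 1)).isClosed.isOpen_compl.mem_nhds hm] with x hx
    exact hf0 x hx
  have hXκ : ∀ m, actJ e m ∉ tsupport κ → hamVF f m = 0 := fun m hm => by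
    refine hX0 m ?_
    have h1 : ∀ᶠ x in 𝓝 m, actJ e x ∉ tsupport κ :=
      (continuous_actJ e).continuousAt.eventually
        ((isClosed_tsupport κ).isOpen_compl.mem_nhds hm)
    filter_upwards [h1] with x hx
    simp [hf, resHam, amp, actV, image_eq_zero_of_notMem_tsupport hx]
  have hax : ∀ m : Ph d, (∃ i, actJ i m = 0) → hamVF f m = 0 := fun m ⟨i, hi⟩ =>
    hXbox m fun hm => (box_pos hm i).ne' hi
  obtain ⟨C, ε, U, hε, hC, hεC, hUs, hU, hm⟩ :=
    exists_midpoint_map hfs (HasCompactSupport.intro (isCompact_box (n + 1)) hf0)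
  obtain ⟨c, hc, hamp⟩ := exists_amp_lower_bound e n a j hσ2 P N
  have hke : resVec a j σ P N e = 0 := by simp [resVec, hea, hej]
  have hka : resVec a j σ P N a = P := by simp [resVec, haj]
  have hUfix : ∀ z, hamVF f z = 0 → U z = z := fun z hz => by simpa [hz] using hU z
  have hUact : ∀ z, ∃ s : ℝ, actV (U z) = actV z + s • resVec a j σ P N ∧
      (s = 0 ∨ actJ e z ∈ tsupport κ) := by
    intro z
    by_cases h : actJ e z ∈ tsupport κ
    · obtain ⟨m, hzm, -⟩ := hm z
      refine ⟨-(2 * ε * (amp κ e n (actV m) * (resMon a j σ P N m).im)), funext fun i => ?_,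
        Or.inr h⟩
      have := actJ_midpoint_resHam hη (a := a) (j := j) hσ P N ε i m
      rw [← hf, ← hU, ← hzm] at this
      simp only [actV, Pi.add_apply, Pi.smul_apply, smul_eq_mul]
      linear_combination this
    · exact ⟨0, by rw [hUfix z (hXκ z h)]; simp, Or.inl rfl⟩
  let S : ℝ → Set (Ph d) := fun τ =>
    {z | (∀ i, actJ i z ≠ 0) ∧ (resMon a j σ P N z).re = 0 ∧ τ * (resMon a j σ P N z).im < 0}
  have hstep : ∀ τ : ℝ, (τ = 1 ∨ τ = -1) → ∀ z ∈ S τ, U z ∈ S τ ∧ ∃ s, 0 ≤ s ∧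
      actV (U z) = actV z + s • (τ • resVec a j σ P N) ∧
      (κ (actJ e z) = 1 → z ∈ box d n → U z ∈ box d n → 2 * ε * c ≤ s) := by
    rintro τ hτ z ⟨hz, hre, him⟩
    have hττ : τ * τ = 1 := by rcases hτ with rfl | rfl <;> norm_num
    obtain ⟨μ, g, hμ, hUz, hact⟩ := midpoint_resHam_eq_scl hη hσ hax hε hC hεC hU hm hz hre
    have hscl : ∀ g : Fin d → ℝ, (∀ i, 0 < g i) → (resMon a j σ P N (scl g z)).re = 0 ∧
        τ * (resMon a j σ P N (scl g z)).im < 0 := by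
      intro g hg
      rw [resMon_scl, Complex.re_ofReal_mul, Complex.im_ofReal_mul, hre, mul_zero]
      refine ⟨rfl, ?_⟩
      have : 0 < g a ^ P * g j ^ N := mul_pos (pow_pos (hg a) _) (pow_pos (hg j) _)
      nlinarith
    obtain ⟨hre', him'⟩ := hscl μ fun i => (hμ i).1
    have hamp0 : 0 ≤ amp κ e n (actV (scl μ z)) :=
      mul_nonneg (hκ0 _) (Finset.prod_nonneg fun i _ => bumpFun_nonneg n _)
    refine ⟨⟨fun i => ?_, ?_⟩, 2 * ε * (amp κ e n (actV (scl μ z)) *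
      -(τ * (resMon a j σ P N (scl μ z)).im)), ?_, funext fun i => ?_, fun h1 h2 h3 => ?_⟩
    · rw [hUz, actJ_scl]
      exact mul_ne_zero (pow_ne_zero _ (hμ i).2.1.ne') (hz i)
    · rw [hUz]
      exact hscl g fun i => (hμ i).2.1
    · exact mul_nonneg (by positivity) (mul_nonneg hamp0 (by linarith))
    · have := hact i
      simp only [actV, Pi.add_apply, Pi.smul_apply, smul_eq_mul] at this ⊢
      linear_combination this + (2 * ε * resVec a j σ P N i *
        (amp κ e n (actV (scl μ z)) * (resMon a j σ P N (scl μ z)).im)) * hττ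
    · have hbox : scl μ z ∈ box d n := by
        refine mem_box_of_between h2 h3 fun i => ?_
        rw [hUz, actJ_scl, actJ_scl]
        have h0 := actJ_nonneg i z
        obtain ⟨p1, p2, p3⟩ := hμ i
        rcases le_total 1 (g i) with hg | hg
        · exact Or.inl ⟨le_mul_of_one_le_left h0 (by nlinarith),
            mul_le_mul_of_nonneg_right (by nlinarith) h0⟩
        · exact Or.inr ⟨mul_le_mul_of_nonneg_right (by nlinarith) h0,
            mul_le_of_le_one_left h0 (by nlinarith)⟩
      have he : actJ e (scl μ z) = actJ e z := by
        have := hact e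
        rw [hke, hUz, actJ_scl] at this
        have hge : g e ^ 2 = 1 := by
          refine mul_right_cancel₀ (hz e) ?_
          linear_combination this
        have hge' : g e = 1 := by nlinarith [(hμ e).2.1]
        have hme : μ e = 1 := by linarith [(hμ e).2.2]
        rw [actJ_scl, hme]; ring
      have := hamp κ _ hbox (he ▸ h1)
      have hnorm : ‖resMon a j σ P N (scl μ z)‖ = -(τ * (resMon a j σ P N (scl μ z)).im) := by
        have h4 : ‖resMon a j σ P N (scl μ z)‖ = |(resMon a j σ P N (scl μ z)).im| :=
          (Complex.abs_im_eq_norm.2 hre').symm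
        rw [h4]
        rcases hτ with rfl | rfl
        · rw [one_mul] at him' ⊢
          exact abs_of_neg him'
        · rw [abs_of_pos (by linarith)]; ring
      rw [hnorm] at this
      nlinarith
  obtain ⟨M, hM⟩ := exists_nat_gt (((n : ℝ) + 1) / (2 * ε * c))
  have hM' : (n : ℝ) + 1 < M * (2 * ε * c) := (div_lt_iff₀ (by positivity)).1 hM
  refine ⟨U ^ M, hUs.pow M, fun z hz => ?_, fun z => ?_, fun q hq hκq => ?_⟩
  · have := hUfix z (hXbox z hz)
    clear hM hM'
    induction M with
    | zero => rfl
    | succ M ih => rw [pow_succ, Equiv.Perm.mul_apply, this, ih]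
  · clear hM hM'
    induction M with
    | zero => exact ⟨0, by simp, Or.inl rfl⟩
    | succ M ih =>
      obtain ⟨s, hs, hs'⟩ := ih
      obtain ⟨t, ht, ht'⟩ := hUact ((U ^ M) z)
      rw [pow_succ', Equiv.Perm.mul_apply]
      refine ⟨s + t, by rw [ht, hs, add_smul, add_assoc], ?_⟩
      have he : actJ e ((U ^ M) z) = actJ e z := by
        have := congrFun hs e
        simpa [hke, actV] using this
      rw [he] at ht'
      rcases hs' with h | h
      · rcases ht' with h' | h'
        · exact Or.inl (by rw [h, h', add_zero])
        · exact Or.inr h'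
      · exact Or.inr h
  · have hZ : resMon a j σ P N q ≠ 0 := resMon_ne_zero hσ2 P N (hq a) (hq j)
    have hpol := Complex.norm_mul_exp_arg_mul_I (resMon a j σ P N q)
    set α := (resMon a j σ P N q).arg with hα
    have hmem : ∀ τ : ℝ, (τ = 1 ∨ τ = -1) → ∀ ν : Fin d → ℝ,
        P * ν a + σ * N * ν j = α + τ * (Real.pi / 2) → rot ν q ∈ S τ := by
      intro τ hτ ν hν
      have h1 : resMon a j σ P N (rot ν q) =
          ((‖resMon a j σ P N q‖ : ℝ) : ℂ) *
            Complex.exp (((-(τ * (Real.pi / 2)) : ℝ) : ℂ) * Complex.I) := by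
        rw [resMon_rot hσ, hν]
        nth_rewrite 1 [← hpol]
        rw [mul_left_comm, ← Complex.exp_add]
        congr 2
        push_cast
        ring
      have hpos : 0 < ‖resMon a j σ P N q‖ := norm_pos_iff.2 hZ
      refine ⟨fun i => by rw [actJ_rot]; exact hq i, ?_, ?_⟩
      · rw [h1, Complex.re_ofReal_mul, Complex.exp_ofReal_mul_I_re]
        rcases hτ with rfl | rfl <;> simp
      · rw [h1, Complex.im_ofReal_mul, Complex.exp_ofReal_mul_I_im]
        rcases hτ with rfl | rfl <;> simpa using hZ
    by_contra! hcon
    have hαb := abs_le.1 (Complex.abs_arg_le_pi (resMon a j σ P N q))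
    rw [← hα] at hαb
    have hπ := Real.pi_pos
    obtain ⟨ν₁, h1, h1'⟩ := hcon (α + 1 * (Real.pi / 2)) (abs_le.2 ⟨by linarith, by linarith⟩)
    obtain ⟨ν₂, h2, h2'⟩ := hcon (α + -1 * (Real.pi / 2)) (abs_le.2 ⟨by linarith, by linarith⟩)
    have hk1 : ((1 : ℝ) • resVec a j σ P N) e = 0 := by simp [hke]
    have hk2 : ((-1 : ℝ) • resVec a j σ P N) e = 0 := by simp [hke]
    obtain ⟨-, s, hs, hact, hdr⟩ := iterate_drift hk1 (hstep 1 (Or.inl rfl)) M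
      (hmem 1 (Or.inl rfl) ν₁ h1)
    obtain ⟨-, t, ht, hact', -⟩ := iterate_drift hk2 (hstep (-1) (Or.inr rfl)) M
      (hmem (-1) (Or.inr rfl) ν₂ h2)
    rw [one_smul, actV_rot] at hact
    rw [actV_rot] at hact'
    have hbox : rot ν₁ q ∈ box d n := by
      refine mem_box_of_segment h2' h1' ht hs (k := resVec a j σ P N) ?_ (by rw [actV_rot, hact])
      rw [actV_rot, hact']
      simp
    have hlow := hdr (by rwa [actJ_rot]) hbox h1'
    have h3 := congrFun hact a
    simp only [actV, Pi.add_apply, Pi.smul_apply, smul_eq_mul, hka] at h3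
    have h4 := (h1' a).2
    have h5 := actJ_nonneg a q
    have hP1 : (1 : ℝ) ≤ P := by exact_mod_cast hP
    nlinarith

/-- A bump function in the variable `1/x`, extended by zero to `x ≤ 0`. -/
def invBump {c : ℝ} (φ : ContDiffBump c) (x : ℝ) : ℝ := if x ≤ 0 then 0 else φ x⁻¹

lemma contDiff_invBump {c : ℝ} (hc : 0 ≤ c) (φ : ContDiffBump c) :
    ContDiff ℝ (⊤ : ℕ∞) (invBump φ) := by
  refine contDiff_iff_contDiffAt.2 fun x => ?_
  rcases lt_or_ge 0 x with hx | hx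
  · have h : ContDiffAt ℝ (⊤ : ℕ∞) (fun y : ℝ => φ y⁻¹) x :=
      φ.contDiffAt.comp x (contDiffAt_inv ℝ hx.ne')
    refine h.congr_of_eventuallyEq ?_
    filter_upwards [lt_mem_nhds hx] with y hy
    rw [invBump, if_neg hy.not_ge]
  · refine (contDiffAt_const (c := (0 : ℝ))).congr_of_eventuallyEq ?_
    have h0 := φ.rOut_pos
    filter_upwards [gt_mem_nhds (lt_of_le_of_lt hx (show 0 < (c + φ.rOut)⁻¹ by positivity))]
      with y hy
    rw [invBump]
    split_ifs with hy0
    · rfl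
    · push Not at hy0
      refine φ.zero_of_le_dist ?_
      have := (lt_inv_comm₀ hy0 (by positivity)).1 hy
      rw [Real.dist_eq]
      exact le_trans (by linarith) (le_abs_self _)

/-- The cutoffs localizing the conjugations. -/
def cutIn (m : ℕ) : ℝ → ℝ :=
  invBump (c := (m : ℝ)) ⟨1 / 2, 3 / 5, by norm_num, by norm_num⟩

/-- The cutoffs localizing the frequency changes. -/
def cutOut (m : ℕ) : ℝ → ℝ :=
  invBump (c := (m : ℝ)) ⟨7 / 10, 9 / 10, by norm_num, by norm_num⟩

lemma contDiff_cutIn (m : ℕ) : ContDiff ℝ (⊤ : ℕ∞) (cutIn m) := contDiff_invBump m.cast_nonneg _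

lemma contDiff_cutOut (m : ℕ) : ContDiff ℝ (⊤ : ℕ∞) (cutOut m) :=
  contDiff_invBump m.cast_nonneg _

lemma cutIn_nonneg (m : ℕ) (x : ℝ) : 0 ≤ cutIn m x := by
  unfold cutIn invBump
  split_ifs
  · exact le_rfl
  · exact ContDiffBump.nonneg _

lemma cutOut_zero (m : ℕ) : cutOut m 0 = 0 := by simp [cutOut, invBump]

lemma exists_cutIn_eq_one {x : ℝ} (hx : 0 < x) : ∃ m, cutIn m x = 1 := by
  refine ⟨(round x⁻¹).toNat, ?_⟩
  have h0 : 0 ≤ round x⁻¹ := by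
    rw [round_eq]
    exact Int.floor_nonneg.2 (by positivity)
  have h1 := abs_sub_round x⁻¹
  rw [cutIn, invBump, if_neg hx.not_ge]
  refine ContDiffBump.one_of_mem_closedBall _ ?_
  rw [mem_closedBall, Real.dist_eq]
  have : (((round x⁻¹).toNat : ℕ) : ℝ) = (round x⁻¹ : ℤ) := by
    exact_mod_cast congrArg (fun z : ℤ => (z : ℝ)) (Int.toNat_of_nonneg h0)
  rwa [this]

lemma pos_of_mem_tsupport_cutIn {m : ℕ} {x : ℝ} (hx : x ∈ tsupport (cutIn m)) :
    0 < x ∧ |x⁻¹ - m| ≤ 3 / 5 := by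
  have hclosed : IsClosed {x : ℝ | |1 - m * x| ≤ 3 / 5 * x} :=
    isClosed_le (by fun_prop) (by fun_prop)
  have hpos : ∀ x : ℝ, 0 < x → |1 - m * x| = |x⁻¹ - m| * x := fun x hx => by
    nth_rewrite 3 [← abs_of_pos hx]
    rw [← abs_mul, sub_mul, inv_mul_cancel₀ hx.ne']
  have hsub : tsupport (cutIn m) ⊆ {x : ℝ | |1 - m * x| ≤ 3 / 5 * x} := by
    refine closure_minimal (fun y hy => ?_) hclosed
    rw [Function.mem_support, cutIn, invBump] at hy
    split_ifs at hy with h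
    · exact absurd rfl hy
    · push Not at h
      have : y⁻¹ ∈ ball (m : ℝ) (3 / 5) := by
        by_contra hcon
        exact hy (ContDiffBump.zero_of_le_dist _ (not_lt.1 hcon))
      rw [mem_ball, Real.dist_eq] at this
      change |1 - m * y| ≤ 3 / 5 * y
      rw [hpos y h]
      exact mul_le_mul_of_nonneg_right this.le h.le
  have h : |1 - m * x| ≤ 3 / 5 * x := hsub hx
  have h0 : 0 < x := by
    rcases lt_trichotomy x 0 with h' | rfl | h'
    · linarith [abs_nonneg (1 - m * x)]
    · norm_num at h
    · exact h'
  rw [hpos x h0] at h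
  exact ⟨h0, le_of_mul_le_mul_right h h0⟩

lemma cutOut_eq_one {m : ℕ} {x : ℝ} (hx : x ∈ tsupport (cutIn m)) : cutOut m x = 1 := by
  obtain ⟨h0, h⟩ := pos_of_mem_tsupport_cutIn hx
  rw [cutOut, invBump, if_neg h0.not_ge]
  refine ContDiffBump.one_of_mem_closedBall _ ?_
  rw [mem_closedBall, Real.dist_eq]
  exact h.trans (by norm_num)

lemma cutOut_eq_zero {m m' : ℕ} (hm : m ≠ m') (hpar : Even m ↔ Even m') {x : ℝ}
    (hx : x ∈ tsupport (cutIn m)) : cutOut m' x = 0 := by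
  obtain ⟨h0, h⟩ := pos_of_mem_tsupport_cutIn hx
  rw [cutOut, invBump, if_neg h0.not_ge]
  refine ContDiffBump.zero_of_le_dist _ ?_
  rw [Real.dist_eq]
  have h2 : m + 2 ≤ m' ∨ m' + 2 ≤ m := by
    rcases lt_or_gt_of_ne hm with h | h
    · left
      by_contra hcon
      obtain rfl : m' = m + 1 := by omega
      rw [Nat.even_add_one] at hpar
      tauto
    · right
      by_contra hcon
      obtain rfl : m = m' + 1 := by omega
      rw [Nat.even_add_one] at hpar
      tauto
  have h3 := abs_le.1 h
  change (9 / 10 : ℝ) ≤ _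
  rcases h2 with h2 | h2
  · have : (m : ℝ) + 2 ≤ m' := by exact_mod_cast h2
    exact le_trans (by linarith) (neg_le_abs _)
  · have : (m' : ℝ) + 2 ≤ m := by exact_mod_cast h2
    exact le_trans (by linarith) (le_abs_self _)

lemma continuous_of_isGlobalFlow {H : Ph d → ℝ} {Φ : ℝ → Ph d → Ph d} (hΦ : IsGlobalFlow H Φ)
    (p : Ph d) : Continuous fun t => Φ t p :=
  continuous_iff_continuousAt.2 fun t => (hΦ.2.2 p t).continuousAt

lemma isGlobalFlow_unique {H : Ph d → ℝ} (hH : ContDiff ℝ (⊤ : ℕ∞) H) {Φ Ψ : ℝ → Ph d → Ph d}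
    (hΦ : IsGlobalFlow H Φ) (hΨ : IsGlobalFlow H Ψ) (t : ℝ) (p : Ph d) : Φ t p = Ψ t p := by
  set T := |t| + 1 with hT
  have hT0 : 0 < T := by positivity
  have htT : t ∈ Icc (-T) T := ⟨by linarith [neg_abs_le t], by linarith [le_abs_self t]⟩
  have hbd : ∀ Φ, IsGlobalFlow H Φ → ∃ R, ∀ s ∈ Icc (-T) T, ‖Φ s p‖ ≤ R := fun Φ h =>
    isCompact_Icc.exists_bound_of_continuousOn (continuous_of_isGlobalFlow h p).continuousOn
  obtain ⟨R₁, h1⟩ := hbd Φ hΦ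
  obtain ⟨R₂, h2⟩ := hbd Ψ hΨ
  obtain ⟨K, hK⟩ := LocallyLipschitzOn.exists_lipschitzOnWith_of_compact
    (isCompact_closedBall (0 : Ph d) (max R₁ R₂))
    (((contDiff_hamVF hH).of_le (m := 1) (by exact_mod_cast le_top)).locallyLipschitz.locallyLipschitzOn)
  refine ODE_solution_unique_of_mem_Icc (v := fun _ => hamVF H)
    (s := fun _ => closedBall (0 : Ph d) (max R₁ R₂)) (t₀ := 0) (fun s _ => hK)
    ⟨by linarith, hT0⟩ (continuous_of_isGlobalFlow hΦ p).continuousOn (fun s _ => hΦ.2.2 p s) (fun s hs => ?_)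
    (continuous_of_isGlobalFlow hΨ p).continuousOn (fun s _ => hΨ.2.2 p s) (fun s hs => ?_)
    (by rw [hΦ.1, hΨ.1]) htT
  · exact mem_closedBall_zero_iff.2 ((h1 s (Ioo_subset_Icc_self hs)).trans (le_max_left _ _))
  · exact mem_closedBall_zero_iff.2 ((h2 s (Ioo_subset_Icc_self hs)).trans (le_max_right _ _))

/-- The data fixed throughout the construction: four coordinates and a nonvanishing
frequency profile `w`. -/
structure Frame (ω : Fin d → ℝ) where
  a : Fin d
  b : Fin d
  c : Fin d
  e : Fin d
  hab : a ≠ b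
  hac : a ≠ c
  hbc : b ≠ c
  hea : e ≠ a
  heb : e ≠ b
  hec : e ≠ c
  w₁ : ℝ
  hw : ω a ≠ 0 ∧ w₁ = 0 ∨ ω = 0 ∧ w₁ = 1

namespace Frame

lemma nonempty (hd : 4 ≤ d) (ω : Fin d → ℝ) : Nonempty (Frame ω) := by
  have key : ∀ a : Fin d, ∃ b c e : Fin d, a ≠ b ∧ a ≠ c ∧ b ≠ c ∧ e ≠ a ∧ e ≠ b ∧ e ≠ c := by
    intro a
    have hc : ∀ s : Finset (Fin d), s.card ≤ 3 → ∃ x, x ∉ s := fun s hs => by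
      by_contra! h
      have : s = Finset.univ := Finset.eq_univ_iff_forall.2 h
      rw [this, Finset.card_univ, Fintype.card_fin] at hs
      omega
    obtain ⟨b, hb⟩ := hc {a} (by simp)
    obtain ⟨c, hc'⟩ := hc {a, b} ((Finset.card_le_two).trans (by norm_num))
    obtain ⟨e, he⟩ := hc {a, b, c} Finset.card_le_three
    simp only [Finset.mem_insert, Finset.mem_singleton, not_or] at hb hc' he
    exact ⟨b, c, e, Ne.symm hb, Ne.symm hc'.1, Ne.symm hc'.2, he.1, he.2.1, he.2.2⟩
  by_cases h : ω = 0
  · obtain ⟨b, c, e, h1, h2, h3, h4, h5, h6⟩ := key ⟨0, by omega⟩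
    exact ⟨⟨_, b, c, e, h1, h2, h3, h4, h5, h6, 1, Or.inr ⟨h, rfl⟩⟩⟩
  · obtain ⟨a, ha⟩ := Function.ne_iff.1 h
    obtain ⟨b, c, e, h1, h2, h3, h4, h5, h6⟩ := key a
    exact ⟨⟨a, b, c, e, h1, h2, h3, h4, h5, h6, 0, Or.inl ⟨ha, rfl⟩⟩⟩

variable {ω : Fin d → ℝ} (F : Frame ω)

/-- The frequency profile as a function of `r_e`. -/
def w (x : ℝ) : ℝ := ω F.a + F.w₁ * x

/-- The plane paired with `a` on the `m`-th interval of values of `r_e`. -/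
def j (m : ℕ) : Fin d := if Even m then F.b else F.c

lemma a_ne_j (m : ℕ) : F.a ≠ F.j m := by
  unfold j; split_ifs; exacts [F.hab, F.hac]

lemma e_ne_j (m : ℕ) : F.e ≠ F.j m := by
  unfold j; split_ifs; exacts [F.heb, F.hec]

lemma j_eq_iff (m m' : ℕ) : F.j m = F.j m' ↔ (Even m ↔ Even m') := by
  unfold j
  split_ifs with h h' h' <;> simp [h, h', F.hbc, F.hbc.symm]

lemma exists_w_lower_bound {x₀ : ℝ} (hx₀ : 0 < x₀) : ∃ c > 0, ∀ x, x₀ ≤ x → c ≤ |F.w x| := by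
  rcases F.hw with ⟨h, h1⟩ | ⟨h, h1⟩
  · exact ⟨|ω F.a|, abs_pos.2 h, fun x _ => by simp [w, h1]⟩
  · exact ⟨x₀, hx₀, fun x hx => by
      simp only [w, h1, h, Pi.zero_apply, zero_add, one_mul]
      exact hx.trans (le_abs_self x)⟩

/-- The increments of the integrable Hamiltonian. -/
def incr (m : ℕ) (r : Fin d → ℝ) : ℝ := F.w (r F.e) * cutOut m (r F.e) * r (F.j m)

lemma contDiff_incr (m : ℕ) : ContDiff ℝ (⊤ : ℕ∞) (F.incr m) := by
  have := contDiff_cutOut m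
  unfold incr w
  fun_prop

lemma freq_eq_of_line {ℓ : (Fin d → ℝ) → ℝ} (hℓ : ContDiff ℝ (⊤ : ℕ∞) ℓ) {r : Fin d → ℝ}
    {i : Fin d} {A B : ℝ} (h : ∀ t : ℝ, ℓ (r + t • Pi.single i 1) = A + B * t) :
    freq ℓ r i = B := by
  have hl : HasDerivAt (fun t : ℝ => r + t • (Pi.single i 1 : Fin d → ℝ)) (Pi.single i 1) 0 := by
    simpa using ((hasDerivAt_id (0 : ℝ)).smul_const (Pi.single i 1 : Fin d → ℝ)).const_add r
  have hd := (hℓ.differentiable (by simp) (r + (0 : ℝ) • (Pi.single i 1 : Fin d → ℝ))).hasFDerivAt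
  have h1 := hd.comp_hasDerivAt (0 : ℝ) hl
  rw [zero_smul, add_zero] at h1
  have h2 : HasDerivAt (fun t : ℝ => A + B * t) B 0 := by
    simpa using ((hasDerivAt_id (0 : ℝ)).const_mul B).const_add A
  exact h1.unique (h2.congr_of_eventuallyEq (.of_forall h))

lemma freq_incr_of_ne (m : ℕ) (r : Fin d → ℝ) {i : Fin d} (hie : i ≠ F.e) (hij : i ≠ F.j m) :
    freq (F.incr m) r i = 0 :=
  freq_eq_of_line (F.contDiff_incr m) (A := F.incr m r) fun t => by
    simp [incr, hie.symm, hij.symm]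

lemma freq_incr (m : ℕ) (r : Fin d → ℝ) :
    freq (F.incr m) r (F.j m) = F.w (r F.e) * cutOut m (r F.e) :=
  freq_eq_of_line (F.contDiff_incr m) (A := F.incr m r) fun t => by
    simp [incr, F.e_ne_j m]
    ring

lemma incr_single (m : ℕ) (i : Fin d) (x : ℝ) : F.incr m (Pi.single i x) = 0 := by
  rcases eq_or_ne i F.e with rfl | h
  · simp [incr, (F.e_ne_j m).symm]
  · simp [incr, h.symm, cutOut_zero]

/-- The initial integrable Hamiltonian. -/
def baseHam (r : Fin d → ℝ) : ℝ := ∑ i, ω i * r i + F.w₁ * r F.e * r F.a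

lemma contDiff_baseHam : ContDiff ℝ (⊤ : ℕ∞) F.baseHam := by
  unfold baseHam
  fun_prop

lemma freq_baseHam {i : Fin d} (hie : i ≠ F.e) (r : Fin d → ℝ) :
    freq F.baseHam r i = ω i + F.w₁ * r F.e * (Pi.single i 1 : Fin d → ℝ) F.a :=
  freq_eq_of_line F.contDiff_baseHam (A := F.baseHam r) fun t => by
    simp only [baseHam, Pi.add_apply, Pi.smul_apply, smul_eq_mul, mul_add, Finset.sum_add_distrib,
      Pi.single_eq_of_ne hie.symm]
    simp [Pi.single_apply]
    split_ifs <;> ring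

lemma baseHam_single (i : Fin d) (x : ℝ) : F.baseHam (Pi.single i x) = ω i * x := by
  rcases eq_or_ne i F.e with rfl | h
  · simp [baseHam, F.hea.symm, Pi.single_apply]
  · simp [baseHam, h.symm, Pi.single_apply]

/-- The initial frequency ratios. -/
def ratio (m : ℕ) : ℝ := ω (F.j m) / ω F.a

lemma freq_baseHam_a (r : Fin d → ℝ) : freq F.baseHam r F.a = F.w (r F.e) := by
  rw [F.freq_baseHam F.hea.symm]; simp [w]

lemma freq_baseHam_j (m : ℕ) (r : Fin d → ℝ) :
    freq F.baseHam r (F.j m) = F.w (r F.e) * F.ratio m := by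
  rw [F.freq_baseHam (F.e_ne_j m).symm, Pi.single_eq_of_ne (F.a_ne_j m), mul_zero, add_zero]
  rcases F.hw with ⟨h, h1⟩ | ⟨h, h1⟩
  · simp [w, h1, ratio]
    field_simp
  · simp [h, ratio]

end Frame

lemma apply_add_smul_eq {ℓ : (Fin d → ℝ) → ℝ} (hℓ : ContDiff ℝ (⊤ : ℕ∞) ℓ) {r k : Fin d → ℝ}
    (h : ∀ s : ℝ, fderiv ℝ ℓ (r + s • k) k = 0) (s : ℝ) : ℓ (r + s • k) = ℓ r := by
  have hder : ∀ s : ℝ, HasDerivAt (fun s : ℝ => ℓ (r + s • k)) 0 s := fun s => by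
    have hl : HasDerivAt (fun t : ℝ => r + t • k) k s := by
      simpa using ((hasDerivAt_id s).smul_const k).const_add r
    have := (hℓ.differentiable (by simp) (r + s • k)).hasFDerivAt.comp_hasDerivAt s hl
    rwa [h s] at this
  have := is_const_of_deriv_eq_zero (fun s => (hder s).differentiableAt)
    (fun s => (hder s).deriv) s 0
  simpa using this

lemma fderiv_resVec (ℓ : (Fin d → ℝ) → ℝ) (r : Fin d → ℝ) (a j : Fin d) (σ : ℝ) (P N : ℕ) :
    fderiv ℝ ℓ r (resVec a j σ P N) = P * freq ℓ r a + σ * N * freq ℓ r j := by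
  have h : ∀ (i : Fin d) (x : ℝ), (Pi.single i x : Fin d → ℝ) = x • Pi.single i 1 := fun i x => by
    rw [← Pi.single_smul', smul_eq_mul, mul_one]
  rw [resVec, map_add, h a, h j, map_smul, map_smul]
  rfl

/-- The `n`-th stage of the construction. -/
structure Stage {ω : Fin d → ℝ} (F : Frame ω) (n : ℕ) where
  Q : Equiv.Perm (Ph d)
  ℓ : (Fin d → ℝ) → ℝ
  B : ℕ → ℝ
  τ : ℝ
  symp : IsSymp Q
  supp : ∀ p ∉ box d n, Q p = p
  actJ_e : ∀ p, actJ F.e (Q p) = actJ F.e p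
  smooth : ContDiff ℝ (⊤ : ℕ∞) ℓ
  freq_a : ∀ m r, r F.e ∈ tsupport (cutIn m) → freq ℓ r F.a = F.w (r F.e)
  freq_j : ∀ m r, r F.e ∈ tsupport (cutIn m) → freq ℓ r (F.j m) = F.w (r F.e) * B m
  axis : ∀ i x, ℓ (Pi.single i x) = ω i * x

namespace Stage

variable {ω : Fin d → ℝ} {F : Frame ω} {n : ℕ} (S : Stage F n)

/-- The Hamiltonian of a stage. -/
def ham : Ph d → ℝ := conjHam S.Q S.ℓ

/-- The flow of a stage. -/
def flow : ℝ → Ph d → Ph d := conjFlow S.Q S.ℓ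

lemma contDiff_ham : ContDiff ℝ (⊤ : ℕ∞) S.ham := contDiff_conjHam S.symp S.smooth

lemma isGlobalFlow : IsGlobalFlow S.ham S.flow := isGlobalFlow_conjFlow S.symp S.smooth

/-- The stage with identity conjugacy. -/
def start (F : Frame ω) : Stage F 0 where
  Q := 1
  ℓ := F.baseHam
  B := F.ratio
  τ := 0
  symp := IsSymp.one
  supp _ _ := rfl
  actJ_e _ := rfl
  smooth := F.contDiff_baseHam
  freq_a _ r _ := F.freq_baseHam_a r
  freq_j m r _ := F.freq_baseHam_j m r
  axis := F.baseHam_single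

/-- The conjugacy used at a resonance. -/
lemma exists_conj (m : ℕ) : ∃ W : Equiv.Perm (Ph d), IsSymp W ∧
    (∀ z ∉ box d (n + 1), W z = z) ∧ (∀ z, actJ F.e (W z) = actJ F.e z) ∧
    (∀ z, S.ℓ (actV (W z)) = S.ℓ (actV z)) ∧
    ((∃ q : ℚ, q ≠ 0 ∧ S.B m = q) → ∃ P N : ℝ, N ≠ 0 ∧ P + N * S.B m = 0 ∧
      ∀ q, (∀ i, actJ i q ≠ 0) → cutIn m (actJ F.e q) = 1 → ∃ θ, |θ| ≤ 2 * Real.pi ∧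
        ∀ ν, P * ν F.a + N * ν (F.j m) = θ → W (rot ν q) ∉ box d n) := by
  by_cases h : ∃ q : ℚ, q ≠ 0 ∧ S.B m = q
  swap
  · exact ⟨1, IsSymp.one, fun _ _ => rfl, fun _ => rfl, fun _ => rfl, fun h' => absurd h' h⟩
  obtain ⟨q, hq, hB⟩ := h
  obtain ⟨σ, hσ, hσq⟩ : ∃ σ : ℝ, (σ = 1 ∨ σ = -1) ∧ (q.num.natAbs : ℝ) + σ * q.den * q = 0 := by
    have hqd : (q.den : ℝ) * q = q.num := by
      have : (q.den : ℚ) * q = q.num := Rat.den_mul_eq_num q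
      exact_mod_cast this
    rw [show (q.num.natAbs : ℝ) = |(q.num : ℝ)| by rw [Nat.cast_natAbs, Int.cast_abs]]
    rcases le_total 0 (q.num : ℝ) with h0 | h0
    · exact ⟨-1, Or.inr rfl, by rw [abs_of_nonneg h0, mul_assoc, hqd]; ring⟩
    · exact ⟨1, Or.inl rfl, by rw [abs_of_nonpos h0, mul_assoc, hqd]; ring⟩
  have hP : 0 < q.num.natAbs := Int.natAbs_pos.2 (Rat.num_ne_zero.2 hq)
  obtain ⟨W, h1, h2, h3, h4⟩ := exists_exit_map (F.a_ne_j m) F.hea (F.e_ne_j m)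
    (contDiff_cutIn m) (cutIn_nonneg m) hσ (N := q.den) hP n
  have hke : resVec F.a (F.j m) σ q.num.natAbs q.den F.e = 0 := by
    simp [resVec, F.hea, F.e_ne_j m]
  have hσ0 : σ ≠ 0 := by rcases hσ with rfl | rfl <;> norm_num
  refine ⟨W, h1, h2, fun z => ?_, fun z => ?_, fun _ => ⟨q.num.natAbs, σ * q.den,
    mul_ne_zero hσ0 (by exact_mod_cast q.den_ne_zero), by rw [hB]; exact hσq, h4⟩⟩
  · obtain ⟨s, hs, -⟩ := h3 z
    simpa [actV, hke] using congrFun hs F.e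
  · obtain ⟨s, hs, hs'⟩ := h3 z
    rcases hs' with rfl | hs'
    · rw [hs, zero_smul, add_zero]
    rw [hs]
    refine apply_add_smul_eq S.smooth (fun s => ?_) s
    have hr : (actV z + s • resVec F.a (F.j m) σ q.num.natAbs q.den) F.e = actJ F.e z := by
      simp [hke, actV]
    rw [fderiv_resVec, S.freq_a m _ (by rwa [hr]), S.freq_j m _ (by rwa [hr]), hB]
    linear_combination F.w ((actV z + s • resVec F.a (F.j m) σ q.num.natAbs q.den) F.e) * hσq

end Stage

lemma freq_add_smul {ℓ g : (Fin d → ℝ) → ℝ} (hℓ : ContDiff ℝ (⊤ : ℕ∞) ℓ)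
    (hg : ContDiff ℝ (⊤ : ℕ∞) g) (ε : ℝ) (r : Fin d → ℝ) :
    freq (ℓ + ε • g) r = freq ℓ r + ε • freq g r := by
  have h1 := hℓ.differentiable (by simp) r
  have h2 := hg.differentiable (by simp) r
  funext i
  simp only [freq, Pi.add_apply, Pi.smul_apply]
  rw [fderiv_add h1 (h2.const_smul ε), fderiv_const_smul h2]
  rfl

lemma eventually_dist_conjFlow_le {Q : Equiv.Perm (Ph d)} (hQ : IsSymp Q)
    {ℓ g : (Fin d → ℝ) → ℝ} (hℓ : ContDiff ℝ (⊤ : ℕ∞) ℓ) (hg : ContDiff ℝ (⊤ : ℕ∞) g)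
    {K : Set (ℝ × Ph d)} (hK : IsCompact K) {η : ℝ} (hη : 0 < η) :
    ∀ᶠ ε : ℝ in 𝓝 0, ∀ q ∈ K,
      dist (conjFlow Q (ℓ + ε • g) q.1 q.2) (conjFlow Q ℓ q.1 q.2) < η := by
  refine hK.eventually_forall_of_forall_eventually fun q _ => ?_
  have hc : Continuous fun z : ℝ × (ℝ × Ph d) =>
      dist (conjFlow Q (ℓ + z.1 • g) z.2.1 z.2.2) (conjFlow Q ℓ z.2.1 z.2.2) := by
    have h1 := continuous_freq hℓ
    have h2 := continuous_freq hg
    have h3 : Continuous (actV : Ph d → Fin d → ℝ) := (contDiff_actV (n := 0)).continuous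
    have h4 := hQ.contDiff.continuous
    have h5 := hQ.contDiff_symm.continuous
    simp only [conjFlow, intFlow, freq_add_smul hℓ hg]
    have ha : Continuous fun z : ℝ × (ℝ × Ph d) =>
        (z.2.1 • (freq ℓ (actV (Q.symm z.2.2)) + z.1 • freq g (actV (Q.symm z.2.2))),
          Q.symm z.2.2) := by fun_prop
    have hb : Continuous fun z : ℝ × (ℝ × Ph d) =>
        (z.2.1 • freq ℓ (actV (Q.symm z.2.2)), Q.symm z.2.2) := by fun_prop
    have ha' := h4.comp (continuous_rot.comp ha)
    have hb' := h4.comp (continuous_rot.comp hb)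
    exact ha'.dist hb'
  refine (hc.tendsto (0, q)).eventually_lt_const ?_
  simpa using hη

lemma eventually_iteratedFDeriv_conjHam_le {Q : Equiv.Perm (Ph d)} (hQ : IsSymp Q)
    (ℓ : (Fin d → ℝ) → ℝ) {g : (Fin d → ℝ) → ℝ} (hg : ContDiff ℝ (⊤ : ℕ∞) g)
    {K : Set (Ph d)} (hK : IsCompact K) (k : ℕ) {η : ℝ} (hη : 0 < η) :
    ∀ᶠ ε : ℝ in 𝓝 0, ∀ p ∈ K,
      ‖iteratedFDeriv ℝ k (fun p => conjHam Q (ℓ + ε • g) p - conjHam Q ℓ p) p‖ < η := by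
  refine hK.eventually_forall_of_forall_eventually fun p _ => ?_
  have hG := contDiff_conjHam hQ hg
  have h : ∀ (ε : ℝ) p, iteratedFDeriv ℝ k (fun p => conjHam Q (ℓ + ε • g) p - conjHam Q ℓ p) p =
      ε • iteratedFDeriv ℝ k (conjHam Q g) p := fun ε p => by
    rw [← iteratedFDeriv_const_smul_apply (hG.contDiffAt.of_le (by exact_mod_cast le_top))]
    congr 1
    funext p
    simp [conjHam]
  simp only [h]
  have hc := hG.continuous_iteratedFDeriv (m := k) (by exact_mod_cast le_top)
  have hc' : Continuous fun z : ℝ × Ph d => ‖z.1 • iteratedFDeriv ℝ k (conjHam Q g) z.2‖ := by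
    fun_prop
  refine (hc'.tendsto (0, p)).eventually_lt_const ?_
  simpa using hη

lemma exists_ne_zero_add_eq_rat (x : ℝ) {p : ℝ → Prop} (hp : ∀ᶠ ε in 𝓝 0, p ε) :
    ∃ ε ≠ 0, p ε ∧ ∃ q : ℚ, q ≠ 0 ∧ x + ε = q := by
  obtain ⟨δ, hδ, h⟩ := Metric.eventually_nhds_iff.1 hp
  have key : ∀ q : ℚ, x < q → q < x + δ → q ≠ 0 → ∃ ε ≠ 0, p ε ∧ ∃ q : ℚ, q ≠ 0 ∧ x + ε = q :=
    fun q h1 h2 h0 => ⟨q - x, (sub_pos.2 h1).ne', h (by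
      rw [Real.dist_eq, sub_zero, abs_of_pos (sub_pos.2 h1)]; linarith), q, h0, by ring⟩
  obtain ⟨q₁, h1, h2⟩ := exists_rat_btwn (lt_add_of_pos_right x hδ)
  obtain ⟨q₂, h3, h4⟩ := exists_rat_btwn h2
  by_cases h0 : q₁ = 0
  · refine key q₂ (h1.trans h3) h4 fun h' => ?_
    rw [h0, h'] at h3
    exact lt_irrefl _ h3
  · exact key q₁ h1 h2 h0

namespace Stage

variable {ω : Fin d → ℝ} {F : Frame ω} {n : ℕ}

lemma conjHam_mul {Q W : Equiv.Perm (Ph d)} {ℓ : (Fin d → ℝ) → ℝ}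
    (hW : ∀ z, ℓ (actV (W z)) = ℓ (actV z)) : conjHam (Q * W) ℓ = conjHam Q ℓ := by
  funext p
  have h := hW (W.symm (Q.symm p))
  rw [W.apply_symm_apply] at h
  exact h.symm

/-- Modify the conjugacy by `W` and the frequency ratio on the `m`-th interval by `ε`. -/
def next (S : Stage F n) (m : ℕ) {W : Equiv.Perm (Ph d)} (h1 : IsSymp W)
    (h2 : ∀ z ∉ box d (n + 1), W z = z) (h3 : ∀ z, actJ F.e (W z) = actJ F.e z) (ε τ : ℝ) :
    Stage F (n + 1) where
  Q := S.Q * W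
  ℓ := S.ℓ + ε • F.incr m
  B := Function.update S.B m (S.B m + ε)
  τ := τ
  symp := S.symp.mul h1
  supp p hp := by
    rw [Equiv.Perm.mul_apply, h2 p hp, S.supp p fun h => hp (box_subset_succ n h)]
  actJ_e p := by rw [Equiv.Perm.mul_apply, S.actJ_e, h3]
  smooth := S.smooth.add ((F.contDiff_incr m).const_smul ε)
  freq_a m' r hr := by
    rw [freq_add_smul S.smooth (F.contDiff_incr m), Pi.add_apply, S.freq_a m' r hr, Pi.smul_apply,
      F.freq_incr_of_ne m r F.hea.symm (F.a_ne_j m), smul_zero, add_zero]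
  freq_j m' r hr := by
    rw [freq_add_smul S.smooth (F.contDiff_incr m), Pi.add_apply, S.freq_j m' r hr, Pi.smul_apply,
      smul_eq_mul]
    rcases eq_or_ne m' m with rfl | hm
    · rw [F.freq_incr, cutOut_eq_one hr, Function.update_self]
      ring
    rw [Function.update_of_ne hm]
    by_cases hj : F.j m' = F.j m
    · rw [hj, F.freq_incr, cutOut_eq_zero hm ((F.j_eq_iff m' m).1 hj) hr]
      ring
    · rw [F.freq_incr_of_ne m r (F.e_ne_j m').symm hj]
      ring
  axis i x := by simp [S.axis, F.incr_single]

/-- `S'` is close to `S`, has a nonzero rational frequency ratio on the `m`-th interval, and, if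
the ratio was already such at `S`, moves the points of the box over that interval out of it. -/
structure IsStep (S : Stage F n) (m : ℕ) (S' : Stage F (n + 1)) : Prop where
  ham_sub_le : ∀ k ≤ n, ∀ p : Ph d, ‖p‖ ≤ n →
    ‖iteratedFDeriv ℝ k (fun p => S'.ham p - S.ham p) p‖ ≤ (1 / 2) ^ n
  dist_flow_le : ∀ (t : ℝ) (p : Ph d), |t| ≤ max (n : ℝ) S.τ → ‖p‖ ≤ n →
    dist (S'.flow t p) (S.flow t p) ≤ (1 / 2) ^ n
  rat : ∃ q : ℚ, q ≠ 0 ∧ S'.B m = q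
  B_of_ne : ∀ m' ≠ m, S'.B m' = S.B m'
  τ_le : S.τ ≤ S'.τ
  exit : (∃ q : ℚ, q ≠ 0 ∧ S.B m = q) → ∀ p ∈ box d n, cutIn m (actJ F.e p) = 1 →
    ∃ t, |t| ≤ S'.τ ∧ S'.flow t p ∉ box d n

theorem exists_step (S : Stage F n) (m : ℕ) : ∃ S' : Stage F (n + 1), S.IsStep m S' := by
  obtain ⟨W, h1, h2, h3, h4, h5⟩ := S.exists_conj m
  have hQW : IsSymp (S.Q * W) := S.symp.mul h1
  have hham : conjHam (S.Q * W) S.ℓ = S.ham := conjHam_mul h4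
  have hflow : ∀ t p, conjFlow (S.Q * W) S.ℓ t p = S.flow t p := fun t p =>
    isGlobalFlow_unique S.contDiff_ham (hham ▸ isGlobalFlow_conjFlow hQW S.smooth)
      S.isGlobalFlow t p
  have hη : (0 : ℝ) < (1 / 2) ^ n := by positivity
  have e1 : ∀ᶠ ε : ℝ in 𝓝 0, ∀ k ≤ n, ∀ p ∈ closedBall (0 : Ph d) n,
      ‖iteratedFDeriv ℝ k (fun p => conjHam (S.Q * W) (S.ℓ + ε • F.incr m) p -
        conjHam (S.Q * W) S.ℓ p) p‖ < (1 / 2) ^ n :=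
    (Set.finite_Iic n).eventually_all.2 fun k _ => eventually_iteratedFDeriv_conjHam_le hQW S.ℓ
      (F.contDiff_incr m) (isCompact_closedBall _ _) k hη
  have e2 := eventually_dist_conjFlow_le hQW S.smooth (F.contDiff_incr m)
    ((isCompact_Icc (a := -max (n : ℝ) S.τ) (b := max (n : ℝ) S.τ)).prod
      (isCompact_closedBall (0 : Ph d) n)) hη
  obtain ⟨ε, hε, ⟨hε1, hε2⟩, hq⟩ := exists_ne_zero_add_eq_rat (S.B m) (e1.and e2)
  obtain ⟨τ, hτ, hexit⟩ : ∃ τ, S.τ ≤ τ ∧ ((∃ q : ℚ, q ≠ 0 ∧ S.B m = q) →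
      ∀ p ∈ box d n, cutIn m (actJ F.e p) = 1 →
      ∃ t, |t| ≤ τ ∧ conjFlow (S.Q * W) (S.ℓ + ε • F.incr m) t p ∉ box d n) := by
    by_cases hB : ∃ q : ℚ, q ≠ 0 ∧ S.B m = q
    swap
    · exact ⟨S.τ, le_rfl, fun h => absurd h hB⟩
    obtain ⟨P, N, hN, hPN, hW⟩ := h5 hB
    obtain ⟨c, hc, hcw⟩ := F.exists_w_lower_bound (x₀ := 1 / ((n : ℝ) + 1)) (by positivity)
    have hcN : 0 < c * (|N| * |ε|) := by positivity
    refine ⟨max S.τ (2 * Real.pi / (c * (|N| * |ε|))), le_max_left _ _, fun _ p hp hcut => ?_⟩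
    let S' := S.next m h1 h2 h3 ε 0
    set q := (S.Q * W).symm p with hqdef
    have hqp : (S.Q * W) q = p := Equiv.apply_symm_apply _ _
    have hqe : actJ F.e q = actJ F.e p := by rw [← hqp]; exact (S'.actJ_e q).symm
    have hq0 : ∀ i, actJ i q ≠ 0 := fun i hi => by
      have : q ∉ box d (n + 1) := fun h => (box_pos h i).ne' hi
      have h' : (S.Q * W) q = q := S'.supp q this
      rw [hqp] at h'
      rw [← h'] at hi
      exact (box_pos hp i).ne' hi
    obtain ⟨θ, hθ, hθW⟩ := hW q hq0 (by rwa [hqe])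
    have hts : actV q F.e ∈ tsupport (cutIn m) := subset_tsupport _ (by
      rw [Function.mem_support, show actV q F.e = actJ F.e p from hqe, hcut]; exact one_ne_zero)
    have ha := S'.freq_a m (actV q) hts
    have hj := S'.freq_j m (actV q) hts
    have hBm : S'.B m = S.B m + ε := Function.update_self ..
    rw [hBm] at hj
    set ν := freq (S.ℓ + ε • F.incr m) (actV q) with hν
    change ν F.a = _ at ha
    change ν (F.j m) = _ at hj
    rw [show actV q F.e = actJ F.e p from hqe] at ha hj
    have hw := hcw (actJ F.e p) (hp F.e).1
    set w := F.w (actJ F.e p)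
    have hs : P * ν F.a + N * ν (F.j m) = w * (N * ε) := by
      rw [ha, hj]; linear_combination w * hPN
    have hw0 : 0 < |w| := hc.trans_le hw
    have hS0 : w * (N * ε) ≠ 0 := mul_ne_zero (abs_pos.1 hw0) (mul_ne_zero hN hε)
    refine ⟨θ / (w * (N * ε)), le_max_of_le_right ?_, ?_⟩
    · rw [abs_div, abs_mul, abs_mul]
      gcongr
    · have hnot := hθW ((θ / (w * (N * ε))) • ν) (by
        simp only [Pi.smul_apply, smul_eq_mul]
        have := div_mul_cancel₀ θ hS0
        rw [← hs] at this ⊢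
        linear_combination this)
      have : conjFlow (S.Q * W) (S.ℓ + ε • F.incr m) (θ / (w * (N * ε))) p =
        W (rot ((θ / (w * (N * ε))) • ν) q) := S.supp _ hnot
      rwa [this]
  refine ⟨S.next m h1 h2 h3 ε τ, fun k hk p hp => ?_, fun t p ht hp => ?_, ?_, fun m' hm' => ?_,
    hτ, hexit⟩
  · rw [← hham]
    exact (hε1 k hk p (mem_closedBall_zero_iff.2 hp)).le
  · rw [← hflow]
    exact (hε2 (t, p) ⟨abs_le.1 ht, mem_closedBall_zero_iff.2 hp⟩).le
  · simpa [next] using hq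
  · exact Function.update_of_ne hm' _ _

end Stage

section Limits

variable {X Y : Type*} [TopologicalSpace X] [MetricSpace Y]

lemma dist_le_of_dist_succ_le {u : ℕ → Y} {y : Y} (hu : Tendsto u atTop (𝓝 y)) {n : ℕ}
    (h : ∀ k ≥ n, dist (u k) (u (k + 1)) ≤ (1 / 2) ^ k) : dist (u n) y ≤ 2 * (1 / 2) ^ n := by
  have h' : ∀ k, dist (u (n + k)) (u (n + (k + 1))) ≤ (1 / 2) ^ n * (1 / 2) ^ k := fun k => by
    rw [← pow_add]; exact h (n + k) (Nat.le_add_right n k)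
  have ht : Tendsto (fun k => u (n + k)) atTop (𝓝 y) := by
    simpa only [add_comm] using (tendsto_add_atTop_iff_nat n).2 hu
  have := dist_le_of_le_geometric_of_tendsto₀ _ _ (by norm_num) h' ht
  rw [add_zero] at this
  exact this.trans_eq (by ring)

lemma exists_tendstoLocallyUniformly [CompleteSpace Y] {F : ℕ → X → Y}
    (hF : ∀ x, ∃ N, ∃ U ∈ 𝓝 x, ∀ n ≥ N, ∀ y ∈ U, dist (F n y) (F (n + 1) y) ≤ (1 / 2) ^ n) :
    ∃ f, TendstoLocallyUniformly F f atTop := by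
  have hlim : ∀ x, ∃ y, Tendsto (fun n => F n x) atTop (𝓝 y) := fun x => by
    obtain ⟨N, U, hU, h⟩ := hF x
    have hc : CauchySeq fun k => F (k + N) x :=
      cauchySeq_of_le_geometric (1 / 2) ((1 / 2) ^ N) (by norm_num) fun k => by
        rw [← pow_add, add_right_comm, add_comm N]
        exact h (k + N) (Nat.le_add_left N k) x (mem_of_mem_nhds hU)
    obtain ⟨y, hy⟩ := cauchySeq_tendsto_of_complete hc
    exact ⟨y, (tendsto_add_atTop_iff_nat N).1 hy⟩
  choose f hf using hlim
  refine ⟨f, Metric.tendstoLocallyUniformly_iff.2 fun ε hε x => ?_⟩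
  obtain ⟨N, U, hU, h⟩ := hF x
  refine ⟨U, hU, ?_⟩
  have h0 : Tendsto (fun n : ℕ => 2 * (1 / 2 : ℝ) ^ n) atTop (𝓝 0) := by
    simpa using (tendsto_pow_atTop_nhds_zero_of_lt_one (r := (1 / 2 : ℝ)) (by norm_num)
      (by norm_num)).const_mul 2
  filter_upwards [h0.eventually_lt_const hε, eventually_ge_atTop N] with n hn hN y hy
  rw [dist_comm]
  exact (dist_le_of_dist_succ_le (hf y) fun k hk => h k (hN.trans hk) y hy).trans_lt hn

end Limits

section SmoothLimits

variable {E : Type} [NormedAddCommGroup E] [NormedSpace ℝ E]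

/-- The successive differences of `f` are eventually at most `(1 / 2) ^ n`, locally uniformly, with
all their derivatives. -/
def FastSmooth {G : Type} [NormedAddCommGroup G] [NormedSpace ℝ G] (f : ℕ → E → G) : Prop :=
  ∀ (k : ℕ) (x : E), ∃ N, ∃ U ∈ 𝓝 x, ∀ n ≥ N, ∀ y ∈ U,
    ‖iteratedFDeriv ℝ k (fun y => f (n + 1) y - f n y) y‖ ≤ (1 / 2) ^ n

variable {G : Type} [NormedAddCommGroup G] [NormedSpace ℝ G] {f : ℕ → E → G}

lemma fastSmooth_fderiv (hf : ∀ n, ContDiff ℝ (⊤ : ℕ∞) (f n)) (h : FastSmooth f) :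
    FastSmooth fun n => fderiv ℝ (f n) := fun k x => by
  obtain ⟨N, U, hU, hN⟩ := h (k + 1) x
  refine ⟨N, U, hU, fun n hn y hy => ?_⟩
  have := hN n hn y hy
  rw [← norm_iteratedFDeriv_fderiv] at this
  convert this using 4
  exact (fderiv_fun_sub ((hf _).differentiable (by simp) _) ((hf _).differentiable (by simp) _)).symm

variable [CompleteSpace G]

lemma exists_tendsto_of_fastSmooth (h : FastSmooth f) :
    ∃ g, TendstoLocallyUniformly f g atTop := by
  refine exists_tendstoLocallyUniformly fun x => ?_
  obtain ⟨N, U, hU, hN⟩ := h 0 x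
  refine ⟨N, U, hU, fun n hn y hy => ?_⟩
  rw [dist_comm, dist_eq_norm]
  simpa using hN n hn y hy

lemma tendsto_fderiv_of_fastSmooth (hf : ∀ n, ContDiff ℝ (⊤ : ℕ∞) (f n)) (h : FastSmooth f)
    {g : E → G} (hg : TendstoLocallyUniformly f g atTop) :
    Differentiable ℝ g ∧ TendstoLocallyUniformly (fun n => fderiv ℝ (f n)) (fderiv ℝ g) atTop := by
  obtain ⟨g', hg'⟩ := exists_tendsto_of_fastSmooth (fastSmooth_fderiv hf h)
  have hd : ∀ x, HasFDerivAt g (g' x) x := fun x =>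
    hasFDerivAt_of_tendstoUniformlyOnFilter (tendstoLocallyUniformly_iff_filter.1 hg' x)
      (.of_forall fun q => ((hf q.1).differentiable (by simp) q.2).hasFDerivAt)
      (.of_forall fun y => hg.tendstoLocallyUniformlyOn.tendsto_at (mem_univ y))
  have he : fderiv ℝ g = g' := funext fun x => (hd x).fderiv
  exact ⟨fun x => (hd x).differentiableAt, he ▸ hg'⟩

lemma contDiff_of_fastSmooth (k : ℕ) : ∀ {G : Type} [NormedAddCommGroup G] [NormedSpace ℝ G]
    [CompleteSpace G] {f : ℕ → E → G} (_ : ∀ n, ContDiff ℝ (⊤ : ℕ∞) (f n)) (_ : FastSmooth f)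
    {g : E → G} (_ : TendstoLocallyUniformly f g atTop), ContDiff ℝ k g := by
  induction k with
  | zero =>
    intro G _ _ _ f hf _ g hg
    exact contDiff_zero.2 (hg.continuous (.of_forall fun n => (hf n).continuous))
  | succ k ih =>
    intro G _ _ _ f hf h g hg
    obtain ⟨h1, h2⟩ := tendsto_fderiv_of_fastSmooth hf h hg
    have := ih (fun n => (hf n).fderiv_right (m := (⊤ : ℕ∞)) (by simp)) (fastSmooth_fderiv hf h) h2
    exact_mod_cast contDiff_succ_iff_fderiv.2 ⟨h1, by simp, this⟩

end SmoothLimits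

lemma tendstoLocallyUniformly_comp_fst {ι κ X Y : Type*} [TopologicalSpace X] [UniformSpace Y]
    {F : ι → X → Y} {f : X → Y} {l : Filter ι} (h : TendstoLocallyUniformly F f l)
    (l' : Filter κ) : TendstoLocallyUniformly (fun q : ι × κ => F q.1) f (l ×ˢ l') := fun u hu x => by
  obtain ⟨U, hU, he⟩ := h u hu x
  exact ⟨U, hU, tendsto_fst.eventually he⟩

lemma isGlobalFlow_of_tendsto {Hs : ℕ → Ph d → ℝ} {H : Ph d → ℝ} {Φs : ℕ → ℝ → Ph d → Ph d}
    {Φ : ℝ → Ph d → Ph d} (hH : ContDiff ℝ (⊤ : ℕ∞) H)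
    (hfderiv : TendstoLocallyUniformly (fun n => fderiv ℝ (Hs n)) (fderiv ℝ H) atTop)
    (hΦs : ∀ n, IsGlobalFlow (Hs n) (Φs n)) (hcont : Continuous fun q : ℝ × Ph d => Φ q.1 q.2)
    (hΦ : TendstoLocallyUniformly (fun n (q : ℝ × Ph d) => Φs n q.1 q.2) (fun q => Φ q.1 q.2)
      atTop) : IsGlobalFlow H Φ := by
  have hpt : ∀ t p, Tendsto (fun n => Φs n t p) atTop (𝓝 (Φ t p)) := fun t p =>
    hΦ.tendstoLocallyUniformlyOn.tendsto_at (mem_univ (t, p))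
  refine ⟨fun p => ?_, fun s t p => ?_, fun p t => ?_⟩
  · refine tendsto_nhds_unique (hpt 0 p) ?_
    simp only [(hΦs _).1, tendsto_const_nhds]
  · refine tendsto_nhds_unique (hpt (s + t) p) ?_
    simp only [(hΦs _).2.1]
    exact hΦ.tendsto_comp hcont.continuousAt
      (tendsto_const_nhds.prodMk_nhds (hpt t p) : Tendsto (fun n => (s, Φs n t p)) atTop
        (𝓝 (s, Φ t p)))
  · refine hasDerivAt_of_tendstoUniformlyOnFilter (l := atTop)
      (f' := fun n τ => hamVF (Hs n) (Φs n τ p)) (g' := fun τ => hamVF H (Φ τ p))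
      (f := fun n τ => Φs n τ p) ?_ (.of_forall fun q => (hΦs q.1).2.2 p q.2)
      (.of_forall fun τ => hpt τ p)
    have hVF : Continuous fun τ => hamVF H (Φ τ p) :=
      (contDiff_hamVF hH).continuous.comp (hcont.comp (by fun_prop : Continuous fun τ => (τ, p)))
    have h1 : Tendsto (fun q : ℕ × ℝ => Φs q.1 q.2 p) (atTop ×ˢ 𝓝 t) (𝓝 (Φ t p)) :=
      (tendstoLocallyUniformly_comp_fst hΦ (𝓝 t)).tendsto_comp (x := (t, p)) hcont.continuousAt
        (tendsto_snd.prodMk_nhds tendsto_const_nhds)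
    have h2 : Tendsto (fun q : ℕ × ℝ => hamVF (Hs q.1) (Φs q.1 q.2 p)) (atTop ×ˢ 𝓝 t)
        (𝓝 (hamVF H (Φ t p))) :=
      ((hamL d).continuous.tendsto _).comp ((tendstoLocallyUniformly_comp_fst hfderiv
        (𝓝 t)).tendsto_comp (hH.continuous_fderiv (by simp)).continuousAt h1)
    rw [tendstoUniformlyOnFilter_iff_tendsto]
    exact (((hVF.tendsto t).comp tendsto_snd).prodMk_nhds h2).mono_right
      (nhds_le_uniformity _)

section NormalForm

variable {G : Ph d → ℝ}

lemma fderiv_eq_zero_of_even {E : Type*} [NormedAddCommGroup E] [NormedSpace ℝ E] {G : E → ℝ}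
    {p v : E} (hG : DifferentiableAt ℝ G p) (h : ∀ t : ℝ, G (p + t • v) = G (p - t • v)) :
    fderiv ℝ G p v = 0 := by
  have h1 : ∀ v, HasDerivAt (fun t : ℝ => G (p + t • v)) (fderiv ℝ G p v) 0 := fun v => by
    have hl : HasDerivAt (fun t : ℝ => p + t • v) v 0 := by
      simpa using ((hasDerivAt_id (0 : ℝ)).smul_const v).const_add p
    have hp : HasFDerivAt G (fderiv ℝ G p) (p + (0 : ℝ) • v) := by simpa using hG.hasFDerivAt
    exact hp.comp_hasDerivAt (0 : ℝ) hl
  have h2 := (h1 v).unique ((h1 (-v)).congr_of_eventuallyEq (.of_forall fun t => by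
    simpa [sub_eq_add_neg] using h t))
  rw [map_neg] at h2
  linarith

lemma clm_eq_zero {N : Type*} [NormedAddCommGroup N] [NormedSpace ℝ N] {L : Ph d →L[ℝ] N}
    (h1 : ∀ i, L (Pi.single i 1, 0) = 0) (h2 : ∀ i, L (0, Pi.single i 1) = 0) : L = 0 := by
  refine ContinuousLinearMap.ext fun v => ?_
  rw [sum_single v]
  simp only [map_sum, map_add, map_smul, h1, h2, smul_zero, add_zero, Finset.sum_const_zero,
    zero_apply]

/-- The vectors supported on the `i`-th plane. -/
def plane (i : Fin d) : Set (Ph d) := {u | ∀ k ≠ i, u.1 k = 0 ∧ u.2 k = 0}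

lemma fst_single_mem_plane (i : Fin d) (x : ℝ) : ((Pi.single i x, 0) : Ph d) ∈ plane i :=
  fun k hk => by simp [hk]

lemma snd_single_mem_plane (i : Fin d) (x : ℝ) : ((0, Pi.single i x) : Ph d) ∈ plane i :=
  fun k hk => by simp [hk]

lemma actV_of_mem_plane {i : Fin d} {u : Ph d} (hu : u ∈ plane i) :
    actV u = Pi.single i (actJ i u) := by
  funext k
  rcases eq_or_ne k i with rfl | hk
  · simp [actV]
  · simp [actV, hk, actJ_eq_zero.2 (hu k hk)]

lemma fderiv_plane (hd : 4 ≤ d) (hG : Differentiable ℝ G)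
    (hA : ∀ p q, (∃ i, actJ i p = 0) → actV p = actV q → G p = G q)
    (hS : ∀ p i x, actV p = Pi.single i x → G p = 0) {i j : Fin d} {u v : Ph d}
    (hu : u ∈ plane i) (hv : v ∈ plane j) : fderiv ℝ G u v = 0 := by
  refine fderiv_eq_zero_of_even (hG u) fun t => ?_
  rcases eq_or_ne i j with rfl | hij
  · have hp : ∀ s : ℝ, u + s • v ∈ plane i := fun s k hk => by
      simp [hu k hk, hv k hk]
    rw [sub_eq_add_neg, ← neg_smul, hS _ i _ (actV_of_mem_plane (hp t)),
      hS _ i _ (actV_of_mem_plane (hp (-t)))]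
  · obtain ⟨k, hk⟩ : ∃ k, k ∉ ({i, j} : Finset (Fin d)) := by
      by_contra! h
      have h3 : ({i, j} : Finset (Fin d)).card ≤ 2 := Finset.card_le_two
      rw [Finset.eq_univ_iff_forall.2 h, Finset.card_univ, Fintype.card_fin] at h3
      omega
    simp only [Finset.mem_insert, Finset.mem_singleton, not_or] at hk
    refine hA _ _ ⟨k, actJ_eq_zero.2 ?_⟩ (funext fun l => ?_)
    · simp [hu k hk.1, hv k hk.2]
    · rcases eq_or_ne l i with rfl | hl
      · simp [actV, actJ, hv l hij]
      · simp [actV, actJ, hu l hl]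

lemma iteratedFDeriv_eq_zero_of_axes (hd : 4 ≤ d) (hG : ContDiff ℝ (⊤ : ℕ∞) G)
    (hA : ∀ p q, (∃ i, actJ i p = 0) → actV p = actV q → G p = G q)
    (hS : ∀ p i x, actV p = Pi.single i x → G p = 0) :
    ∀ k ≤ 2, iteratedFDeriv ℝ k G 0 = 0 := by
  have hdG : Differentiable ℝ G := hG.differentiable (by simp)
  have hdG' : Differentiable ℝ (fderiv ℝ G) :=
    (hG.fderiv_right (m := (⊤ : ℕ∞)) (by simp)).differentiable (by simp)
  have key : ∀ {i : Fin d} {u : Ph d}, u ∈ plane i → fderiv ℝ G u = 0 := fun hu =>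
    clm_eq_zero (fun j => fderiv_plane hd hdG hA hS hu (fst_single_mem_plane j 1))
      (fun j => fderiv_plane hd hdG hA hS hu (snd_single_mem_plane j 1))
  have h0 : ∀ i : Fin d, (0 : Ph d) ∈ plane i := fun i k _ => by simp
  have key2 : ∀ {i : Fin d} {u : Ph d}, u ∈ plane i → fderiv ℝ (fderiv ℝ G) 0 u = 0 := by
    intro i u hu
    have hl : HasDerivAt (fun t : ℝ => t • u) u 0 := by
      simpa using (hasDerivAt_id (0 : ℝ)).smul_const u
    have hp : HasFDerivAt (fderiv ℝ G) (fderiv ℝ (fderiv ℝ G) 0) ((0 : ℝ) • u) := by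
      simpa using (hdG' 0).hasFDerivAt
    refine (hp.comp_hasDerivAt (0 : ℝ) hl).unique
      ((hasDerivAt_const (0 : ℝ) 0).congr_of_eventuallyEq (.of_forall fun t => ?_))
    exact key (i := i) fun k hk => by simp [hu k hk]
  have i₀ : Fin d := ⟨0, by omega⟩
  intro k hk
  interval_cases k
  · ext m
    rw [iteratedFDeriv_zero_apply, hS 0 i₀ _ (actV_of_mem_plane (h0 i₀))]
    rfl
  · ext m
    rw [iteratedFDeriv_one_apply, key (h0 i₀)]
    rfl
  · ext m
    rw [iteratedFDeriv_two_apply, clm_eq_zero (fun i => key2 (fst_single_mem_plane i 1))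
      (fun i => key2 (snd_single_mem_plane i 1))]
    rfl

end NormalForm

namespace Frame

variable {ω : Fin d → ℝ} (F : Frame ω)

/-- The sequence of stages; the `n`-th step treats the interval given by the first component
of `n.unpair`, so that every interval is treated infinitely often. -/
def stage : ∀ n, Stage F n
  | 0 => Stage.start F
  | n + 1 => ((stage n).exists_step n.unpair.1).choose

lemma stage_spec (n : ℕ) : (F.stage n).IsStep n.unpair.1 (F.stage (n + 1)) :=
  ((F.stage n).exists_step n.unpair.1).choose_spec

lemma eventually_rat (m : ℕ) : ∀ᶠ n in atTop, ∃ q : ℚ, q ≠ 0 ∧ (F.stage n).B m = q := by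
  refine eventually_atTop.2 ⟨Nat.pair m 0 + 1, fun n hn => ?_⟩
  induction n, hn using Nat.le_induction with
  | base =>
    have := (F.stage_spec (Nat.pair m 0)).rat
    simp only [Nat.unpair_pair] at this
    exact this
  | succ n _ ih =>
    rcases eq_or_ne m n.unpair.1 with rfl | hm
    · exact (F.stage_spec n).rat
    · obtain ⟨q, hq, h⟩ := ih
      exact ⟨q, hq, ((F.stage_spec n).B_of_ne m hm).trans h⟩

lemma stage_τ_mono : Monotone fun n => (F.stage n).τ :=
  monotone_nat_of_le_succ fun n => (F.stage_spec n).τ_le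

lemma frequently_exit {p : Ph d} (hp : ∀ i, actJ i p ≠ 0) :
    ∃ᶠ n in atTop, ∃ t, |t| ≤ (F.stage (n + 1)).τ ∧ (F.stage (n + 1)).flow t p ∉ box d n := by
  have hpos : ∀ i, 0 < actJ i p := fun i => (actJ_nonneg i p).lt_of_ne (hp i).symm
  obtain ⟨m, hm⟩ := exists_cutIn_eq_one (hpos F.e)
  have hbox : ∀ᶠ n : ℕ in atTop, p ∈ box d n := by
    refine eventually_all.2 fun i => ?_
    have h1 : ∀ᶠ n : ℕ in atTop, 1 / ((n : ℝ) + 1) < actJ i p :=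
      tendsto_one_div_add_atTop_nhds_zero_nat.eventually_lt_const (hpos i)
    filter_upwards [h1, tendsto_natCast_atTop_atTop.eventually_ge_atTop (actJ i p)] with n h2 h3
    exact ⟨h2.le, by linarith⟩
  have hfreq : ∃ᶠ n : ℕ in atTop, n.unpair.1 = m :=
    frequently_atTop.2 fun k => ⟨Nat.pair m k, Nat.right_le_pair m k, by simp⟩
  refine (hfreq.and_eventually (hbox.and (F.eventually_rat m))).mono fun n hn => ?_
  obtain ⟨rfl, hpn, hq⟩ := hn
  exact (F.stage_spec n).exit hq p hpn hm

lemma fastSmooth_stage : FastSmooth fun n => (F.stage n).ham := fun k x => by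
  obtain ⟨N, hN⟩ := exists_nat_ge (‖x‖ + 1)
  refine ⟨max k N, ball x 1, ball_mem_nhds x one_pos, fun n hn y hy => ?_⟩
  refine (F.stage_spec n).ham_sub_le k ((le_max_left _ _).trans hn) y ?_
  have h1 : (N : ℝ) ≤ n := by exact_mod_cast (le_max_right _ _).trans hn
  have h2 := norm_le_norm_add_norm_sub' y x
  rw [← dist_eq_norm] at h2
  linarith [mem_ball.1 hy]

lemma dist_flow_le {n : ℕ} {t : ℝ} {p : Ph d} (ht : |t| ≤ max (n : ℝ) (F.stage n).τ)
    (hp : ‖p‖ ≤ n) :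
    dist ((F.stage n).flow t p) ((F.stage (n + 1)).flow t p) ≤ (1 / 2) ^ n := by
  rw [dist_comm]
  exact (F.stage_spec n).dist_flow_le t p ht hp

lemma exists_limit_flow : ∃ Φ : ℝ → Ph d → Ph d, TendstoLocallyUniformly
    (fun n (q : ℝ × Ph d) => (F.stage n).flow q.1 q.2) (fun q => Φ q.1 q.2) atTop := by
  obtain ⟨Ψ, hΨ⟩ := exists_tendstoLocallyUniformly
    (F := fun n (q : ℝ × Ph d) => (F.stage n).flow q.1 q.2) fun x => by
      obtain ⟨N, hN⟩ := exists_nat_ge (‖x‖ + 1)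
      refine ⟨N, ball x 1, ball_mem_nhds x one_pos, fun n hn y hy => ?_⟩
      have h1 : (N : ℝ) ≤ n := by exact_mod_cast hn
      have h2 := norm_le_norm_add_norm_sub' y x
      rw [← dist_eq_norm] at h2
      have h3 : ‖y‖ ≤ n := by linarith [mem_ball.1 hy]
      exact F.dist_flow_le (le_max_of_le_left ((norm_fst_le y).trans h3)) ((norm_snd_le y).trans h3)
  exact ⟨fun t p => Ψ (t, p), hΨ⟩

end Frame

namespace Stage

variable {ω : Fin d → ℝ} {F : Frame ω} {n : ℕ} (S : Stage F n) {p : Ph d}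

lemma symm_apply_of_axis (hp : ∃ i, actJ i p = 0) : S.Q.symm p = p := by
  rw [Equiv.symm_apply_eq, S.supp p]
  obtain ⟨i, hi⟩ := hp
  exact fun h => (box_pos h i).ne' hi

lemma ham_of_axis (hp : ∃ i, actJ i p = 0) : S.ham p = S.ℓ (actV p) := by
  rw [ham, conjHam, S.symm_apply_of_axis hp]

lemma actJ_flow_of_axis (hp : ∃ i, actJ i p = 0) (j : Fin d) (t : ℝ) :
    actJ j (S.flow t p) = actJ j p := by
  have h : ∃ i, actJ i (intFlow S.ℓ t p) = 0 := by
    obtain ⟨i, hi⟩ := hp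
    exact ⟨i, by rw [intFlow, actJ_rot, hi]⟩
  rw [flow, conjFlow, S.symm_apply_of_axis hp, ← (Equiv.symm_apply_eq _).1 (S.symm_apply_of_axis h)]
  exact actJ_rot _ _ _

end Stage

lemma Stage.continuous_flow {ω : Fin d → ℝ} {F : Frame ω} {n : ℕ} (S : Stage F n) :
    Continuous fun q : ℝ × Ph d => S.flow q.1 q.2 := by
  have h1 := continuous_freq S.smooth
  have h3 : Continuous (actV : Ph d → Fin d → ℝ) := (contDiff_actV (n := 0)).continuous
  have h4 := S.symp.contDiff.continuous
  have h5 := S.symp.contDiff_symm.continuous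
  have hb : Continuous fun q : ℝ × Ph d =>
      (q.1 • freq S.ℓ (actV (S.Q.symm q.2)), S.Q.symm q.2) := by fun_prop
  have h := h4.comp (continuous_rot.comp hb)
  simp only [Stage.flow, conjFlow, intFlow]
  exact h

lemma contDiff_actJ (j : Fin d) : ContDiff ℝ (⊤ : ℕ∞) (actJ j) :=
  contDiff_pi.1 contDiff_actV j

lemma actJ_le_norm_sq (i : Fin d) (p : Ph d) : actJ i p ≤ ‖p‖ ^ 2 := by
  have h1 : |p.1 i| ≤ ‖p‖ := (norm_le_pi_norm p.1 i).trans (norm_fst_le p)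
  have h2 : |p.2 i| ≤ ‖p‖ := (norm_le_pi_norm p.2 i).trans (norm_snd_le p)
  have h3 := pow_le_pow_left₀ (abs_nonneg _) h1 2
  have h4 := pow_le_pow_left₀ (abs_nonneg _) h2 2
  rw [sq_abs] at h3 h4
  simp only [actJ]
  linarith

lemma infDist_axes_le (i : Fin d) (p : Ph d) :
    infDist p {q : Ph d | ∃ i, actJ i q = 0} ≤ √(2 * actJ i p) := by
  let q : Ph d := (Function.update p.1 i 0, Function.update p.2 i 0)
  have hq : q ∈ {q : Ph d | ∃ i, actJ i q = 0} := ⟨i, actJ_eq_zero.2 (by simp [q])⟩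
  refine (infDist_le_dist_of_mem hq).trans ?_
  have key : ∀ (v : Fin d → ℝ), v i ^ 2 ≤ 2 * actJ i p →
      dist v (Function.update v i 0) ≤ √(2 * actJ i p) := fun v hv => by
    refine (dist_pi_le_iff (Real.sqrt_nonneg _)).2 fun k => ?_
    rcases eq_or_ne k i with rfl | hk
    · rw [Function.update_self, Real.dist_eq, sub_zero]
      exact Real.abs_le_sqrt hv
    · rw [Function.update_of_ne hk, dist_self]
      exact Real.sqrt_nonneg _
  refine max_le (key p.1 ?_) (key p.2 ?_) <;> simp only [actJ] <;>
    nlinarith [sq_nonneg (p.1 i), sq_nonneg (p.2 i)]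

namespace Frame

variable {ω : Fin d → ℝ} (F : Frame ω)

lemma isEllipticNF_of_tendsto (hd : 4 ≤ d) {H : Ph d → ℝ} (hH : ContDiff ℝ (⊤ : ℕ∞) H)
    (h : ∀ p, Tendsto (fun n => (F.stage n).ham p) atTop (𝓝 (H p))) : IsEllipticNF ω H := by
  refine iteratedFDeriv_eq_zero_of_axes hd
    (hH.sub (ContDiff.sum fun j _ => contDiff_const.mul (contDiff_actJ j))) ?_ ?_
  · rintro p q ⟨i, hi⟩ hpq
    have hact : ∀ j, actJ j p = actJ j q := congrFun hpq
    have hHpq : H p = H q := tendsto_nhds_unique (h p) ((h q).congr fun n => by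
      rw [(F.stage n).ham_of_axis ⟨i, hi⟩, (F.stage n).ham_of_axis ⟨i, (hact i).symm.trans hi⟩,
        hpq])
    simp only [hHpq, hact]
  · intro p i x hp
    have hact : ∀ j, actJ j p = (Pi.single i x : Fin d → ℝ) j := congrFun hp
    have : Nontrivial (Fin d) := Fin.nontrivial_iff_two_le.2 (by omega)
    obtain ⟨k, hk⟩ := exists_ne i
    have hHp : H p = ω i * x := tendsto_nhds_unique (h p) (tendsto_const_nhds.congr fun n => by
      rw [(F.stage n).ham_of_axis ⟨k, by rw [hact, Pi.single_eq_of_ne hk]⟩, hp, (F.stage n).axis])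
    simp [hHp, hact, Pi.single_apply]

lemma actJ_of_tendsto {Φ : ℝ → Ph d → Ph d} {t : ℝ} {p : Ph d}
    (h : Tendsto (fun n => (F.stage n).flow t p) atTop (𝓝 (Φ t p))) (hp : ∃ i, actJ i p = 0)
    (j : Fin d) : actJ j (Φ t p) = actJ j p :=
  tendsto_nhds_unique (((continuous_actJ j).tendsto _).comp h)
    (tendsto_const_nhds.congr fun n => ((F.stage n).actJ_flow_of_axis hp j t).symm)

lemma frequently_dist_le {Φ : ℝ → Ph d → Ph d} {p : Ph d}
    (h : ∀ t, Tendsto (fun n => (F.stage n).flow t p) atTop (𝓝 (Φ t p)))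
    (hp : ∀ i, actJ i p ≠ 0) :
    ∃ᶠ n : ℕ in atTop, ∃ t, ∃ z ∉ box d n, dist z (Φ t p) ≤ 2 * (1 / 2) ^ n := by
  obtain ⟨N, hN⟩ := exists_nat_ge ‖p‖
  refine ((F.frequently_exit hp).and_eventually (eventually_ge_atTop N)).mono ?_
  rintro n ⟨⟨t, ht, hz⟩, hn⟩
  refine ⟨t, _, hz, ?_⟩
  refine (dist_le_of_dist_succ_le (h t) fun k hk => F.dist_flow_le
    (ht.trans (le_max_of_le_right (F.stage_τ_mono hk))) ?_).trans ?_
  · exact hN.trans (by exact_mod_cast hn.trans (by omega))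
  · rw [pow_succ]
    have : (0 : ℝ) < (1 / 2) ^ n := by positivity
    linarith

lemma exists_times {Φ : ℝ → Ph d → Ph d} {p : Ph d}
    (h : ∀ t, Tendsto (fun n => (F.stage n).flow t p) atTop (𝓝 (Φ t p)))
    (hp : ∀ i, actJ i p ≠ 0) : ∃ t : ℕ → ℝ,
      Tendsto (fun j => ‖Φ (t j) p‖) atTop atTop ∨
      Tendsto (fun j => infDist (Φ (t j) p) {q : Ph d | ∃ i, actJ i q = 0}) atTop (𝓝 0) := by
  have hfreq : ∃ᶠ n : ℕ in atTop, (∃ t, √(n + 1 : ℝ) - 2 * (1 / 2) ^ n ≤ ‖Φ t p‖) ∨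
      ∃ t, infDist (Φ t p) {q : Ph d | ∃ i, actJ i q = 0} ≤
        √(2 * (1 / (n + 1 : ℝ))) + 2 * (1 / 2) ^ n := by
    refine (F.frequently_dist_le h hp).mono ?_
    rintro n ⟨t, z, hz, hdist⟩
    simp only [box, Set.mem_ofPred_eq, not_forall, not_and_or, not_le] at hz
    obtain ⟨i, hi | hi⟩ := hz
    · refine Or.inr ⟨t, infDist_le_infDist_add_dist.trans (add_le_add
        ((infDist_axes_le i z).trans (Real.sqrt_le_sqrt ?_)) (by rwa [dist_comm]))⟩
      linarith
    · refine Or.inl ⟨t, ?_⟩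
      have h1 : √(n + 1 : ℝ) ≤ ‖z‖ :=
        Real.sqrt_le_iff.2 ⟨norm_nonneg z, hi.le.trans (actJ_le_norm_sq i z)⟩
      have h2 := norm_sub_norm_le z (Φ t p)
      rw [← dist_eq_norm] at h2
      linarith
  have hpow : Tendsto (fun n : ℕ => (2 : ℝ) * (1 / 2) ^ n) atTop (𝓝 0) := by
    simpa using (tendsto_pow_atTop_nhds_zero_of_lt_one (r := (1 / 2 : ℝ)) (by norm_num)
      (by norm_num)).const_mul 2
  rcases Filter.frequently_or_distrib.1 hfreq with hf | hf
  · obtain ⟨φ, hφ, hφ'⟩ := extraction_of_frequently_atTop hf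
    choose t ht using hφ'
    refine ⟨t, Or.inl (tendsto_atTop_mono ht ?_)⟩
    have hsqrt : Tendsto (fun n : ℕ => √(n + 1 : ℝ)) atTop atTop :=
      Real.tendsto_sqrt_atTop.comp (tendsto_atTop_add_const_right _ _ tendsto_natCast_atTop_atTop)
    have := (hsqrt.atTop_add hpow.neg).comp hφ.tendsto_atTop
    simpa only [Function.comp_def, ← sub_eq_add_neg] using this
  · obtain ⟨φ, hφ, hφ'⟩ := extraction_of_frequently_atTop hf
    choose t ht using hφ'
    refine ⟨t, Or.inr (squeeze_zero (fun _ => infDist_nonneg) ht ?_)⟩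
    have hsqrt : Tendsto (fun n : ℕ => √(2 * (1 / (n + 1 : ℝ)))) atTop (𝓝 0) := by
      have := (tendsto_one_div_add_atTop_nhds_zero_nat (𝕜 := ℝ)).const_mul 2
      simpa using this.sqrt
    have := (hsqrt.add hpow).comp hφ.tendsto_atTop
    rwa [add_zero] at this

theorem exists_limit_ham : ∃ H : Ph d → ℝ, ContDiff ℝ (⊤ : ℕ∞) H ∧
    TendstoLocallyUniformly (fun n => (F.stage n).ham) H atTop ∧
    TendstoLocallyUniformly (fun n => fderiv ℝ (F.stage n).ham) (fderiv ℝ H) atTop := by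
  have hs : ∀ n, ContDiff ℝ (⊤ : ℕ∞) (F.stage n).ham := fun n => (F.stage n).contDiff_ham
  obtain ⟨H, hH⟩ := exists_tendsto_of_fastSmooth F.fastSmooth_stage
  exact ⟨H, contDiff_infty.2 fun k => contDiff_of_fastSmooth k hs F.fastSmooth_stage hH, hH,
    (tendsto_fderiv_of_fastSmooth hs F.fastSmooth_stage hH).2⟩

theorem exists_isGlobalFlow : ∃ H : Ph d → ℝ, ∃ Φ : ℝ → Ph d → Ph d,
    ContDiff ℝ (⊤ : ℕ∞) H ∧ IsGlobalFlow H Φ ∧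
    (∀ p, Tendsto (fun n => (F.stage n).ham p) atTop (𝓝 (H p))) ∧
    ∀ t p, Tendsto (fun n => (F.stage n).flow t p) atTop (𝓝 (Φ t p)) := by
  obtain ⟨H, hsmooth, hH, hfderiv⟩ := F.exists_limit_ham
  obtain ⟨Φ, hΦ⟩ := F.exists_limit_flow
  have hcont : Continuous fun q : ℝ × Ph d => Φ q.1 q.2 :=
    hΦ.continuous (Frequently.of_forall fun n => (F.stage n).continuous_flow)
  have hflow : IsGlobalFlow H Φ :=
    isGlobalFlow_of_tendsto hsmooth hfderiv (fun n => (F.stage n).isGlobalFlow) hcont hΦ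
  refine ⟨H, Φ, hsmooth, hflow, fun p => ?_, fun t p => ?_⟩
  · exact hH.tendstoLocallyUniformlyOn.tendsto_at (mem_univ p)
  · have h := hΦ.tendstoLocallyUniformlyOn.tendsto_at (mem_univ ((t, p) : ℝ × Ph d))
    exact h

end Frame

end EllipticHam

theorem statement0 (d : ℕ) (hd : 4 ≤ d) (ω₀ : Fin d → ℝ) :
    ∃ H : Ph d → ℝ, ContDiff ℝ (⊤ : ℕ∞) H ∧ IsEllipticNF ω₀ H ∧
      ∃ Φ : ℝ → Ph d → Ph d, IsGlobalFlow H Φ ∧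
        (∀ i : Fin d, ∀ t : ℝ, ∀ p : Ph d, actJ i p = 0 → actJ i (Φ t p) = 0) ∧
        (∀ p : Ph d, (∃ i, actJ i p = 0) → ∀ j : Fin d, ∀ t : ℝ,
          actJ j (Φ t p) = actJ j p) ∧
        (∀ p : Ph d, (∀ i, actJ i p ≠ 0) →
          ∃ t : ℕ → ℝ,
            Tendsto (fun j => ‖Φ (t j) p‖) atTop atTop ∨
            Tendsto (fun j => infDist (Φ (t j) p) {q : Ph d | ∃ i, actJ i q = 0})
              atTop (𝓝 0)) := by
  obtain ⟨F⟩ := EllipticHam.Frame.nonempty hd ω₀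
  obtain ⟨H, Φ, hsmooth, hflow, hH, hΦ⟩ := F.exists_isGlobalFlow
  exact ⟨H, hsmooth, F.isEllipticNF_of_tendsto hd hsmooth hH, Φ, hflow,
    fun i t p hp => (F.actJ_of_tendsto (hΦ t p) ⟨i, hp⟩ i).trans hp,
    fun p hp j t => F.actJ_of_tendsto (hΦ t p) hp j,
    fun p hp => F.exists_times (fun t => hΦ t p) hp⟩
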